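/- arXiv:1909.02347 — 5 statements merged into one kernel-verified Lean document; each statement's English description precedes it below -/
import Mathlib

section
/- For any nondecreasing function I:[0,∞)→[0,1] and any constants ℓ>0, κ>0 and θ0∈(0,π/2), the optimization problem (OP1) has at least one solution: there exist h>0 and a measurable function θ*:[0,h]→[θ0,π/2] with ∫₀ʰ (1/sin θ*(y)) dy = ℓ such that ∫₀ʰ I(y) g(θ*(y)) dy ≥ ∫₀^{h'} I(y) g(θ(y)) dy for every h'>0 and every measurable θ:[0,h']→[θ0,π/2] satisfying ∫₀^{h'} (1/sin θ(y)) dy = ℓ. Moreover θ* can be taken non-increasing. -/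
open Real MeasureTheory

/-- The sunlight-capture density `g(θ) = (1 − e^{−κ/cos(θ−θ0)})·cos(θ−θ0)/sin θ`. -/
noncomputable def g (θ0 κ θ : ℝ) : ℝ :=
  (1 - Real.exp (-κ / Real.cos (θ - θ0))) * Real.cos (θ - θ0) / Real.sin θ

section

open Filter Topology Set
open scoped ENNReal

/-- Helly's selection theorem for antitone functions. -/
theorem exists_subseq_tendsto_ae_of_antitone {a b : ℝ} (f : ℕ → ℝ → ℝ)
    (hf : ∀ n, Antitone (f n)) (hab : ∀ n x, f n x ∈ Icc a b) :
    ∃ (φ : ℕ → ℕ) (F : ℝ → ℝ), StrictMono φ ∧ Antitone F ∧ (∀ x, F x ∈ Icc a b) ∧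
      ∀ᵐ x, Tendsto (fun n => f (φ n) x) atTop (𝓝 (F x)) := by
  have hK : IsCompact (univ.pi fun _ : ℚ => Icc a b) := isCompact_univ_pi fun _ => isCompact_Icc
  obtain ⟨G, hG, φ, hφ, hlim⟩ :=
    hK.tendsto_subseq (x := fun n (q : ℚ) => f n q) (fun n q _ => hab n q)
  have hlimq : ∀ q : ℚ, Tendsto (fun n => f (φ n) q) atTop (𝓝 (G q)) :=
    fun q => (tendsto_pi_nhds.1 hlim) q
  have hGab : ∀ q, G q ∈ Icc a b := fun q => hG q trivial
  have hne : ∀ x : ℝ, (G '' {q : ℚ | (q : ℝ) < x}).Nonempty := fun x =>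
    Set.Nonempty.image G (exists_rat_lt x)
  have hbdd : ∀ x : ℝ, BddBelow (G '' {q : ℚ | (q : ℝ) < x}) := fun x =>
    ⟨a, by rintro _ ⟨q, -, rfl⟩; exact (hGab q).1⟩
  have hF : Antitone fun x : ℝ => sInf (G '' {q : ℚ | (q : ℝ) < x}) := fun x y hxy =>
    csInf_le_csInf (hbdd y) (hne x) (image_mono fun q hq => lt_of_lt_of_le hq hxy)
  refine ⟨φ, _, hφ, hF, fun x => ⟨?_, ?_⟩, ?_⟩
  · exact le_csInf (hne x) (by rintro _ ⟨q, -, rfl⟩; exact (hGab q).1)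
  · obtain ⟨_, q, hq, rfl⟩ := hne x
    exact (csInf_le (hbdd x) ⟨q, hq, rfl⟩).trans (hGab q).2
  · filter_upwards [hF.countable_not_continuousAt.ae_notMem volume] with x hx
    have hx : ContinuousAt _ x := not_not.1 hx
    refine tendsto_order.2 ⟨fun c hc => ?_, fun c hc => ?_⟩
    · have h1 := (hx.tendsto.eventually (lt_mem_nhds hc)).filter_mono
        (nhdsWithin_le_nhds (s := Ioi x))
      obtain ⟨y, hy, hxy⟩ := (h1.and self_mem_nhdsWithin).exists
      obtain ⟨q, hxq, hqy⟩ := exists_rat_btwn hxy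
      have hc' : c < G q := hy.trans_le (csInf_le (hbdd y) ⟨q, hqy, rfl⟩)
      filter_upwards [(hlimq q).eventually (lt_mem_nhds hc')] with n hn
      exact hn.trans_le (hf _ hxq.le)
    · obtain ⟨_, ⟨q, hq, rfl⟩, hqc⟩ := exists_lt_of_csInf_lt (hne x) hc
      filter_upwards [(hlimq q).eventually (gt_mem_nhds hqc)] with n hn
      exact (hf _ (le_of_lt hq)).trans_lt hn

/-- Hardy–Littlewood inequality: among the functions with a given distribution, a monotone one
maximizes the integral over upper sets. -/
theorem setLIntegral_le_of_map_eq_of_isUpperSet {α : Type*} [LinearOrder α] [MeasurableSpace α]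
    {μ : Measure α} [IsFiniteMeasure μ] {u v : α → ℝ≥0∞} (hu : Measurable u) (hv : Measurable v)
    (hmono : Monotone v) (hmap : μ.map u = μ.map v) {s : Set α} (hs : IsUpperSet s)
    (hsm : MeasurableSet s) :
    ∫⁻ y in s, u y ∂μ ≤ ∫⁻ y in s, v y ∂μ := by
  rcases s.eq_empty_or_nonempty with rfl | hne
  · simp
  set c : ℝ≥0∞ := ⨅ y ∈ s, v y with hc
  have hcs : ∀ y ∈ s, c ≤ v y := fun y hy => iInf₂_le y hy
  have hcn : ∀ y ∉ s, v y ≤ c := fun y hy => le_iInf₂ fun z hz =>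
    hmono (le_of_not_ge fun hzy => hy (hs hzy hz))
  have htr : Measurable fun x : ℝ≥0∞ => x - c := measurable_id.sub_const c
  have heq : ∫⁻ y, (u y - c) ∂μ = ∫⁻ y, (v y - c) ∂μ := by
    rw [← lintegral_map htr hu, hmap, lintegral_map htr hv]
  have hind : ∫⁻ y, (v y - c) ∂μ = ∫⁻ y in s, (v y - c) ∂μ := by
    rw [← lintegral_indicator hsm]
    refine lintegral_congr fun y => ?_
    by_cases hy : y ∈ s
    · simp [hy]
    · simp [hy, tsub_eq_zero_of_le (hcn y hy)]
  calc ∫⁻ y in s, u y ∂μ ≤ ∫⁻ y in s, ((u y - c) + c) ∂μ :=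
        lintegral_mono fun y => le_tsub_add
    _ = ∫⁻ y in s, (u y - c) ∂μ + ∫⁻ y in s, c ∂μ := lintegral_add_right _ measurable_const
    _ ≤ ∫⁻ y, (u y - c) ∂μ + ∫⁻ y in s, c ∂μ := by gcongr; exact Measure.restrict_le_self
    _ = ∫⁻ y in s, ((v y - c) + c) ∂μ := by
        rw [heq, hind, lintegral_add_right _ measurable_const]
    _ = ∫⁻ y in s, v y ∂μ :=
        setLIntegral_congr_fun hsm fun y hy => tsub_add_cancel_of_le (hcs y hy)

/-- Hardy–Littlewood inequality: among the functions with a given distribution, a monotone one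
maximizes the integral against a monotone weight. -/
theorem lintegral_mul_le_of_map_eq {μ : Measure ℝ} [IsFiniteMeasure μ] {u v : ℝ → ℝ≥0∞}
    (hu : Measurable u) (hv : Measurable v) (hmono : Monotone v) (hmap : μ.map u = μ.map v)
    {w : ℝ → ℝ} (hw : Monotone w) (hw0 : ∀ y, 0 ≤ w y) :
    ∫⁻ y, ENNReal.ofReal (w y) * u y ∂μ ≤ ∫⁻ y, ENNReal.ofReal (w y) * v y ∂μ := by
  have key : ∀ {z : ℝ → ℝ≥0∞}, Measurable z → ∫⁻ y, ENNReal.ofReal (w y) * z y ∂μ =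
      ∫⁻ t in Ioi 0, ∫⁻ y in {y | t < w y}, z y ∂μ := fun {z} hz => by
    have hd := lintegral_withDensity_eq_lintegral_mul μ hz hw.measurable.ennreal_ofReal
    simp only [Pi.mul_apply, mul_comm (z _)] at hd
    rw [← hd, lintegral_eq_lintegral_meas_lt _ (ae_of_all _ hw0) hw.measurable.aemeasurable]
    exact lintegral_congr fun t => withDensity_apply _ (hw.measurable measurableSet_Ioi)
  rw [key hu, key hv]
  exact lintegral_mono fun t => setLIntegral_le_of_map_eq_of_isUpperSet hu hv hmono hmap
    (fun x y hxy (hx : t < w x) => hx.trans_le (hw hxy)) (hw.measurable measurableSet_Ioi)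

/-- The decreasing rearrangement on `(0, h]` of a function with values in `[a, b]`. -/
theorem exists_antitone_map_eq {a b h : ℝ} (hab : a ≤ b) (hh : 0 ≤ h) {f : ℝ → ℝ}
    (hf : Measurable f) (hfab : ∀ y ∈ Icc 0 h, f y ∈ Icc a b) :
    ∃ F : ℝ → ℝ, Antitone F ∧ (∀ y, F y ∈ Icc a b) ∧
      (volume.restrict (Ioc 0 h)).map F = (volume.restrict (Ioc 0 h)).map f := by
  set μ := volume.restrict (Ioc 0 h) with hμ
  set d : ℝ → ℝ≥0∞ := fun t => μ (f ⁻¹' Ioi t) with hd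
  have hd_anti : Antitone d := fun s t hst =>
    measure_mono (preimage_mono (Ioi_subset_Ioi hst))
  have hdb : d b = 0 := by
    have : ∀ᵐ y ∂μ, ¬ b < f y := by
      filter_upwards [ae_restrict_mem measurableSet_Ioc] with y hy
      exact not_lt.2 (hfab y (Ioc_subset_Icc_self hy)).2
    rw [ae_iff] at this
    simp only [not_not] at this
    exact this
  have hd_right : ∀ t c, (∀ s, t < s → d s ≤ c) → d t ≤ c := fun t c hc => by
    obtain ⟨s, hs, hts, hlim⟩ := exists_seq_strictAnti_tendsto t
    have hU : f ⁻¹' Ioi t = ⋃ n, f ⁻¹' Ioi (s n) := by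
      rw [← preimage_iUnion]
      congr 1
      ext x
      simp only [mem_Ioi, mem_iUnion]
      exact ⟨fun hx => (hlim.eventually (gt_mem_nhds hx)).exists,
        fun ⟨n, hn⟩ => (hts n).trans hn⟩
    have hm : Monotone fun n => f ⁻¹' Ioi (s n) := fun m n hmn =>
      preimage_mono (Ioi_subset_Ioi (hs.antitone hmn))
    change μ (f ⁻¹' Ioi t) ≤ c
    rw [hU, hm.measure_iUnion]
    exact iSup_le fun n => hc _ (hts n)
  set A : ℝ → Set ℝ := fun y => {t | t ∈ Icc a b ∧ d t ≤ ENNReal.ofReal y} with hA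
  have hbA : ∀ y, b ∈ A y := fun y => ⟨right_mem_Icc.2 hab, by simp [hdb]⟩
  have hAbdd : ∀ y, BddBelow (A y) := fun y => ⟨a, fun t ht => ht.1.1⟩
  have hFab : ∀ y, sInf (A y) ∈ Icc a b := fun y =>
    ⟨le_csInf ⟨b, hbA y⟩ fun t ht => ht.1.1, csInf_le (hAbdd y) (hbA y)⟩
  have hF : Antitone fun y => sInf (A y) := fun x y hxy =>
    csInf_le_csInf (hAbdd y) ⟨b, hbA x⟩
      fun t ht => ⟨ht.1, ht.2.trans (ENNReal.ofReal_le_ofReal hxy)⟩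
  have hFle : ∀ y, ∀ t ∈ Icc a b, t < sInf (A y) ↔ ENNReal.ofReal y < d t := fun y t ht => by
    rw [← not_le, ← not_le, not_iff_not]
    refine ⟨fun hle => hd_right t _ fun s hs => ?_, fun hle => csInf_le (hAbdd y) ⟨ht, hle⟩⟩
    obtain ⟨r, hr, hrs⟩ := exists_lt_of_csInf_lt ⟨b, hbA y⟩ (hle.trans_lt hs)
    exact (hd_anti hrs.le).trans hr.2
  refine ⟨_, hF, hFab, ?_⟩
  have hμfin : IsFiniteMeasure μ := by rw [hμ]; infer_instance
  have := Measure.isFiniteMeasure_map μ fun y => sInf (A y)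
  refine ext_of_generate_finite (range Ioi) (borel_eq_generateFrom_Ioi ℝ ▸ BorelSpace.measurable_eq)
    isPiSystem_Ioi ?_ ?_
  · rintro _ ⟨t, rfl⟩
    rw [Measure.map_apply hF.measurable measurableSet_Ioi, Measure.map_apply hf measurableSet_Ioi]
    rcases lt_or_ge t a with hta | hta
    · refine measure_congr ?_
      filter_upwards [ae_restrict_mem measurableSet_Ioc] with y hy
      exact propext ⟨fun _ => hta.trans_le (hfab y (Ioc_subset_Icc_self hy)).1,
        fun _ => hta.trans_le (hFab y).1⟩
    rcases lt_or_ge b t with htb | htb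
    · have h0 : μ (f ⁻¹' Ioi t) = 0 := le_antisymm (hdb ▸ hd_anti htb.le) zero_le
      rw [h0, show (fun y => sInf (A y)) ⁻¹' Ioi t = ∅ from
        eq_empty_of_forall_notMem fun y hy => (htb.trans hy).not_ge (hFab y).2, measure_empty]
    have hdh : d t ≤ ENNReal.ofReal h := by
      refine (measure_mono (subset_univ _)).trans ?_
      simp [hμ]
    obtain ⟨c, hc0, hc⟩ : ∃ c : ℝ, 0 ≤ c ∧ d t = ENNReal.ofReal c :=
      ⟨(d t).toReal, ENNReal.toReal_nonneg,
        (ENNReal.ofReal_toReal (hdh.trans_lt ENNReal.ofReal_lt_top).ne).symm⟩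
    have hch : c ≤ h := (ENNReal.ofReal_le_ofReal_iff hh).1 (hc ▸ hdh)
    have hset : (fun y => sInf (A y)) ⁻¹' Ioi t ∩ Ioc 0 h = Ioo 0 c := by
      ext y
      simp only [mem_inter_iff, mem_preimage, mem_Ioi, mem_Ioc, mem_Ioo, hFle y t ⟨hta, htb⟩, hc]
      constructor
      · rintro ⟨h1, h2, -⟩
        exact ⟨h2, (ENNReal.ofReal_lt_ofReal_iff_of_nonneg h2.le).1 h1⟩
      · rintro ⟨h1, h2⟩
        exact ⟨(ENNReal.ofReal_lt_ofReal_iff_of_nonneg h1.le).2 h2, h1, h2.le.trans hch⟩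
    rw [hμ, Measure.restrict_apply (hF.measurable measurableSet_Ioi), hset, Real.volume_Ioo,
      sub_zero, ← hc]
  · rw [Measure.map_apply hF.measurable .univ, Measure.map_apply hf .univ, preimage_univ,
      preimage_univ]

theorem measurable_g (θ0 κ : ℝ) : Measurable (g θ0 κ) := by
  unfold g
  fun_prop

theorem cos_sub_pos {θ0 θ : ℝ} (hθ0 : θ0 ∈ Ioo 0 (π / 2)) (hθ : θ ∈ Icc θ0 (π / 2)) :
    0 < cos (θ - θ0) :=
  cos_pos_of_mem_Ioo ⟨by linarith [hθ.1, pi_pos], by linarith [hθ.2, hθ0.1]⟩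

theorem sin_pos_of_mem_Icc {θ0 θ : ℝ} (hθ0 : θ0 ∈ Ioo 0 (π / 2)) (hθ : θ ∈ Icc θ0 (π / 2)) :
    0 < sin θ :=
  sin_pos_of_pos_of_lt_pi (hθ0.1.trans_le hθ.1) (by linarith [hθ.2, pi_pos])

theorem continuousOn_one_div_sin {θ0 : ℝ} (hθ0 : θ0 ∈ Ioo 0 (π / 2)) :
    ContinuousOn (fun θ => 1 / sin θ) (Icc θ0 (π / 2)) :=
  continuousOn_const.div continuous_sin.continuousOn fun _ hθ => (sin_pos_of_mem_Icc hθ0 hθ).ne'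

theorem continuousOn_g {θ0 : ℝ} (κ : ℝ) (hθ0 : θ0 ∈ Ioo 0 (π / 2)) :
    ContinuousOn (g θ0 κ) (Icc θ0 (π / 2)) := by
  have hc : ContinuousOn (fun θ => cos (θ - θ0)) (Icc θ0 (π / 2)) := by fun_prop
  have he : ContinuousOn (fun θ => -κ / cos (θ - θ0)) (Icc θ0 (π / 2)) :=
    continuousOn_const.div hc fun _ hθ => (cos_sub_pos hθ0 hθ).ne'
  exact ((continuousOn_const.sub he.rexp).mul hc).div continuous_sin.continuousOn
    fun _ hθ => (sin_pos_of_mem_Icc hθ0 hθ).ne'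

theorem one_sub_exp_neg_div_mul_le {κ x y : ℝ} (hx : 0 < x) (hxy : x ≤ y) :
    (1 - exp (-κ / x)) * x ≤ (1 - exp (-κ / y)) * y := by
  have hy : 0 < y := hx.trans_le hxy
  have h := convexOn_exp.2 (mem_univ (-κ / x)) (mem_univ (0 : ℝ)) 
    (show 0 ≤ x / y by positivity) (show 0 ≤ 1 - x / y from sub_nonneg.2 ((div_le_one hy).2 hxy))
    (by ring)
  have e : (x / y) • (-κ / x) + (1 - x / y) • (0 : ℝ) = -κ / y := by
    simp only [smul_eq_mul]
    field_simp
    ring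
  rw [e, exp_zero] at h
  have h2 := mul_le_mul_of_nonneg_left h hy.le
  have e2 : y * ((x / y) • exp (-κ / x) + (1 - x / y) • (1 : ℝ)) = x * exp (-κ / x) + y - x := by
    simp only [smul_eq_mul]
    field_simp
    ring
  linarith

theorem one_sub_exp_neg_div_mul_nonneg {κ x : ℝ} (hκ : 0 < κ) (hx : 0 < x) :
    0 ≤ (1 - exp (-κ / x)) * x :=
  mul_nonneg (sub_nonneg.2 (exp_le_one_iff.2 (by rw [neg_div]; exact neg_nonpos.2 (by positivity))))
    hx.le

theorem g_nonneg {θ0 κ θ : ℝ} (hθ0 : θ0 ∈ Ioo 0 (π / 2)) (hκ : 0 < κ)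
    (hθ : θ ∈ Icc θ0 (π / 2)) : 0 ≤ g θ0 κ θ :=
  div_nonneg (one_sub_exp_neg_div_mul_nonneg hκ (cos_sub_pos hθ0 hθ))
    (sin_pos_of_mem_Icc hθ0 hθ).le

theorem antitoneOn_g {θ0 κ : ℝ} (hθ0 : θ0 ∈ Ioo 0 (π / 2)) (hκ : 0 < κ) :
    AntitoneOn (g θ0 κ) (Icc θ0 (π / 2)) := fun s hs t ht hst => by
  refine div_le_div₀ (one_sub_exp_neg_div_mul_nonneg hκ (cos_sub_pos hθ0 hs))
    (one_sub_exp_neg_div_mul_le (cos_sub_pos hθ0 ht) ?_) (sin_pos_of_mem_Icc hθ0 hs) ?_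
  · exact cos_le_cos_of_nonneg_of_le_pi (by linarith [hs.1])
      (by linarith [ht.2, hθ0.1, pi_pos]) (by linarith)
  · exact sin_le_sin_of_le_of_le_pi_div_two (by linarith [hs.1, hθ0.1, pi_pos]) ht.2 hst

theorem intervalIntegrable_mul_comp {a b h C : ℝ} (hh : 0 ≤ h) {w H θ : ℝ → ℝ}
    (hw : Measurable w) (hw1 : ∀ y, |w y| ≤ 1) (hH : Measurable H)
    (hHC : ∀ x ∈ Icc a b, |H x| ≤ C) (hθ : Measurable θ) (hθab : ∀ y ∈ Icc 0 h, θ y ∈ Icc a b) :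
    IntervalIntegrable (fun y => w y * H (θ y)) volume 0 h := by
  rw [intervalIntegrable_iff_integrableOn_Ioc_of_le hh]
  refine Integrable.of_bound (C := C) (hw.mul (hH.comp hθ)).aestronglyMeasurable ?_
  filter_upwards [ae_restrict_mem measurableSet_Ioc] with y hy
  have h1 := hHC _ (hθab y (Ioc_subset_Icc_self hy))
  rw [Real.norm_eq_abs, abs_mul]
  exact (mul_le_of_le_one_left (abs_nonneg _) (hw1 y)).trans h1

theorem tendsto_intervalIntegral_mul_comp {a b L C h : ℝ} {w H θ : ℝ → ℝ} {hs : ℕ → ℝ}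
    {θs : ℕ → ℝ → ℝ} (hw : Measurable w) (hw1 : ∀ y, |w y| ≤ 1) (hH : Measurable H)
    (hHC : ∀ x ∈ Icc a b, |H x| ≤ C) (hHcont : ContinuousOn H (Icc a b))
    (hθs : ∀ n, Measurable (θs n)) (hθsab : ∀ n y, θs n y ∈ Icc a b)
    (hθab : ∀ y, θ y ∈ Icc a b) (hlim : ∀ᵐ y, Tendsto (fun n => θs n y) atTop (𝓝 (θ y)))
    (hs0 : ∀ n, hs n ∈ Icc 0 L) (hh : 0 ≤ h) (hslim : Tendsto hs atTop (𝓝 h)) :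
    Tendsto (fun n => ∫ y in (0 : ℝ)..hs n, w y * H (θs n y)) atTop
      (𝓝 (∫ y in (0 : ℝ)..h, w y * H (θ y))) := by
  have hC : 0 ≤ C := (abs_nonneg _).trans (hHC _ (hθab 0))
  have hbd : ∀ n y, |w y * H (θs n y)| ≤ C := fun n y => by
    rw [abs_mul]
    exact (mul_le_of_le_one_left (abs_nonneg _) (hw1 y)).trans (hHC _ (hθsab n y))
  have hIoc : ∀ {c : ℝ} (f : ℝ → ℝ), 0 ≤ c →
      ∫ y in (0 : ℝ)..c, f y = ∫ y, (Ioc 0 c).indicator f y := fun f hc => by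
    rw [intervalIntegral.integral_of_le hc, integral_indicator measurableSet_Ioc]
  simp only [hIoc _ hh, fun n => hIoc (fun y => w y * H (θs n y)) (hs0 n).1]
  refine tendsto_integral_of_dominated_convergence ((Ioc 0 L).indicator fun _ => C)
    (fun n => ((hw.mul (hH.comp (hθs n))).indicator measurableSet_Ioc).aestronglyMeasurable)
    ((integrable_indicator_iff measurableSet_Ioc).2 (integrableOn_const measure_Ioc_lt_top.ne))
    (fun n => ae_of_all _ fun y => ?_) ?_
  · by_cases hy : y ∈ Ioc 0 (hs n)
    · rw [indicator_of_mem hy, indicator_of_mem (Ioc_subset_Ioc_right (hs0 n).2 hy)]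
      exact hbd n y
    · rw [indicator_of_notMem hy, norm_zero]
      exact indicator_nonneg (fun _ _ => hC) y
  · filter_upwards [hlim, Measure.ae_ne volume h] with y hy hyh
    rcases le_or_gt y 0 with hy0 | hy0
    · simp [hy0.not_gt]
    rcases hyh.lt_or_gt with hlt | hgt
    · rw [indicator_of_mem (s := Ioc 0 h) ⟨hy0, hlt.le⟩]
      have hHl : Tendsto (fun n => H (θs n y)) atTop (𝓝 (H (θ y))) :=
        (hHcont _ (hθab y)).tendsto.comp
          (tendsto_nhdsWithin_iff.2 ⟨hy, Eventually.of_forall fun n => hθsab n y⟩)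
      refine (hHl.const_mul (w y)).congr' ?_
      filter_upwards [hslim.eventually (lt_mem_nhds hlt)] with n hn
      rw [indicator_of_mem (show y ∈ Ioc 0 (hs n) from ⟨hy0, hn.le⟩)]
    · rw [indicator_of_notMem fun hm : y ∈ Ioc 0 h => hgt.not_ge hm.2]
      refine tendsto_const_nhds.congr' ?_
      filter_upwards [hslim.eventually (gt_mem_nhds hgt)] with n hn
      rw [indicator_of_notMem fun hm : y ∈ Ioc 0 (hs n) => hn.not_ge hm.2]

/-- Replacing a control by its decreasing rearrangement keeps the length constraint and does not
decrease the payoff. -/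
theorem exists_antitone_ge {θ0 κ h : ℝ} (hθ0 : θ0 ∈ Ioo 0 (π / 2)) (hκ : 0 < κ) (hh : 0 ≤ h)
    {w θ : ℝ → ℝ} (hw : Monotone w) (hw01 : ∀ y, w y ∈ Icc (0 : ℝ) 1) (hθ : Measurable θ)
    (hθab : ∀ y ∈ Icc 0 h, θ y ∈ Icc θ0 (π / 2)) :
    ∃ F : ℝ → ℝ, Antitone F ∧ (∀ y, F y ∈ Icc θ0 (π / 2)) ∧
      (∫ y in (0 : ℝ)..h, 1 / sin (F y)) = (∫ y in (0 : ℝ)..h, 1 / sin (θ y)) ∧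
      (∫ y in (0 : ℝ)..h, w y * g θ0 κ (θ y)) ≤ ∫ y in (0 : ℝ)..h, w y * g θ0 κ (F y) := by
  obtain ⟨F, hF, hFab, hmap⟩ := exists_antitone_map_eq hθ0.2.le hh hθ hθab
  obtain ⟨C, hC⟩ := isCompact_Icc.exists_bound_of_continuousOn (continuousOn_g κ hθ0)
  have hw1 : ∀ y, |w y| ≤ 1 := fun y => abs_le.2 ⟨by linarith [(hw01 y).1], (hw01 y).2⟩
  have hg := measurable_g θ0 κ
  refine ⟨F, hF, hFab, ?_, ?_⟩
  · have hm : Measurable fun t : ℝ => 1 / sin t := by fun_prop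
    simp only [intervalIntegral.integral_of_le hh]
    rw [← integral_map (f := fun t => 1 / sin t) hF.measurable.aemeasurable
      hm.aestronglyMeasurable, hmap, integral_map hθ.aemeasurable hm.aestronglyMeasurable]
  · have hint := intervalIntegrable_mul_comp hh hw.measurable hw1 hg hC hθ hθab
    have hintF := intervalIntegrable_mul_comp hh hw.measurable hw1 hg hC hF.measurable
      fun y _ => hFab y
    rw [intervalIntegrable_iff_integrableOn_Ioc_of_le hh] at hint hintF
    simp only [intervalIntegral.integral_of_le hh]
    have hnn : ∀ y, 0 ≤ w y * g θ0 κ (F y) := fun y =>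
      mul_nonneg (hw01 y).1 (g_nonneg hθ0 hκ (hFab y))
    have hge : Measurable fun t => ENNReal.ofReal (g θ0 κ t) := hg.ennreal_ofReal
    rw [← ENNReal.ofReal_le_ofReal_iff (integral_nonneg hnn),
      ofReal_integral_eq_lintegral_ofReal hintF (ae_of_all _ hnn),
      ofReal_integral_eq_lintegral_ofReal hint]
    · have hmul : ∀ y q, ENNReal.ofReal (w y * q) = ENNReal.ofReal (w y) * ENNReal.ofReal q :=
        fun y q => ENNReal.ofReal_mul (hw01 y).1
      simp only [hmul]
      refine lintegral_mul_le_of_map_eq (hge.comp hθ) (hge.comp hF.measurable) (fun x y hxy =>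
        ENNReal.ofReal_le_ofReal (antitoneOn_g hθ0 hκ (hFab y) (hFab x) (hF hxy))) ?_ hw
        fun y => (hw01 y).1
      rw [← Measure.map_map hge hθ, ← Measure.map_map hge hF.measurable, hmap]
    · filter_upwards [ae_restrict_mem measurableSet_Ioc] with y hy
      exact mul_nonneg (hw01 y).1 (g_nonneg hθ0 hκ (hθab y (Ioc_subset_Icc_self hy)))

theorem height_mem_Icc {θ0 ℓ h : ℝ} (hθ0 : θ0 ∈ Ioo 0 (π / 2)) (hh : 0 ≤ h) {θ : ℝ → ℝ}
    (hθ : Measurable θ) (hθab : ∀ y ∈ Icc 0 h, θ y ∈ Icc θ0 (π / 2))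
    (hℓ : (∫ y in (0 : ℝ)..h, 1 / sin (θ y)) = ℓ) : h ∈ Icc (ℓ * sin θ0) ℓ := by
  have hs0 := sin_pos_of_mem_Icc hθ0 (left_mem_Icc.2 hθ0.2.le)
  obtain ⟨C, hC⟩ := isCompact_Icc.exists_bound_of_continuousOn (continuousOn_one_div_sin hθ0)
  have hint : IntervalIntegrable (fun y => 1 / sin (θ y)) volume 0 h := by
    simpa using intervalIntegrable_mul_comp (w := fun _ => 1) hh measurable_const (by simp)
      (by fun_prop) hC hθ hθab
  constructor
  · have := intervalIntegral.integral_mono_on hh hint (intervalIntegrable_const (c := 1 / sin θ0))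
      fun y hy => one_div_le_one_div_of_le hs0 (sin_le_sin_of_le_of_le_pi_div_two
        (by linarith [hθ0.1, pi_pos]) (hθab y hy).2 (hθab y hy).1)
    rw [hℓ, intervalIntegral.integral_const, sub_zero, smul_eq_mul, mul_one_div,
      le_div_iff₀ hs0] at this
    exact this
  · have := intervalIntegral.integral_mono_on hh (intervalIntegrable_const (c := (1 : ℝ))) hint
      fun y hy => (one_le_div (sin_pos_of_mem_Icc hθ0 (hθab y hy))).2 (sin_le_one _)
    rw [hℓ, intervalIntegral.integral_const, sub_zero, smul_eq_mul, mul_one] at this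
    exact this

/-- The payoff attains its maximum among the antitone controls. -/
theorem exists_isGreatest_antitone {θ0 κ ℓ : ℝ} (hθ0 : θ0 ∈ Ioo 0 (π / 2)) (hℓ : 0 < ℓ)
    {w : ℝ → ℝ} (hw : Measurable w) (hw1 : ∀ y, |w y| ≤ 1) :
    ∃ h θ, 0 < h ∧ Antitone θ ∧ (∀ y, θ y ∈ Icc θ0 (π / 2)) ∧
      (∫ y in (0 : ℝ)..h, 1 / sin (θ y)) = ℓ ∧
      ∀ h' θ', 0 < h' → Antitone θ' → (∀ y, θ' y ∈ Icc θ0 (π / 2)) →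
        (∫ y in (0 : ℝ)..h', 1 / sin (θ' y)) = ℓ →
        (∫ y in (0 : ℝ)..h', w y * g θ0 κ (θ' y)) ≤ ∫ y in (0 : ℝ)..h, w y * g θ0 κ (θ y) := by
  have hs0 := sin_pos_of_mem_Icc hθ0 (left_mem_Icc.2 hθ0.2.le)
  obtain ⟨C, hC⟩ := isCompact_Icc.exists_bound_of_continuousOn (continuousOn_g κ hθ0)
  obtain ⟨D, hD⟩ := isCompact_Icc.exists_bound_of_continuousOn (continuousOn_one_div_sin hθ0)
  let S : Set ℝ := {j | ∃ h θ, 0 < h ∧ Antitone θ ∧ (∀ y, θ y ∈ Icc θ0 (π / 2)) ∧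
    (∫ y in (0 : ℝ)..h, 1 / sin (θ y)) = ℓ ∧ (∫ y in (0 : ℝ)..h, w y * g θ0 κ (θ y)) = j}
  have hne : S.Nonempty :=
    ⟨_, ℓ, fun _ => π / 2, hℓ, antitone_const, fun _ => right_mem_Icc.2 hθ0.2.le, by simp, rfl⟩
  have hbdd : BddAbove S := by
    refine ⟨C * ℓ, ?_⟩
    rintro _ ⟨h, θ, hh, hθ, hθab, hint, rfl⟩
    have hhI := height_mem_Icc hθ0 hh.le hθ.measurable (fun y _ => hθab y) hint
    have hC0 : 0 ≤ C := (norm_nonneg _).trans (hC _ (hθab 0))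
    have := intervalIntegral.norm_integral_le_of_norm_le_const (a := 0) (b := h) (C := C)
      (f := fun y => w y * g θ0 κ (θ y)) fun y _ => by
        rw [norm_mul]
        exact (mul_le_of_le_one_left (norm_nonneg _) (hw1 y)).trans (hC _ (hθab y))
    rw [sub_zero, abs_of_pos hh] at this
    exact (le_abs_self _).trans (this.trans (mul_le_mul_of_nonneg_left hhI.2 hC0))
  obtain ⟨u, -, hu, huS⟩ := exists_seq_tendsto_sSup hne hbdd
  choose hs θs hs0' hθs hθsab hθsint hθsval using huS
  have hsI : ∀ n, hs n ∈ Icc (ℓ * sin θ0) ℓ := fun n =>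
    height_mem_Icc hθ0 (hs0' n).le (hθs n).measurable (fun y _ => hθsab n y) (hθsint n)
  obtain ⟨φ, θ, hφ, hθ, hθab, hlim⟩ := exists_subseq_tendsto_ae_of_antitone θs hθs hθsab
  obtain ⟨h, hhI, ψ, hψ, hhlim⟩ := isCompact_Icc.tendsto_subseq fun n => hsI (φ n)
  have hh : 0 < h := (mul_pos hℓ hs0).trans_le hhI.1
  have conv : ∀ {v H : ℝ → ℝ} {B : ℝ}, Measurable v → (∀ y, |v y| ≤ 1) → Measurable H →
      (∀ x ∈ Icc θ0 (π / 2), ‖H x‖ ≤ B) → ContinuousOn H (Icc θ0 (π / 2)) →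
      Tendsto (fun n => ∫ y in (0 : ℝ)..hs (φ (ψ n)), v y * H (θs (φ (ψ n)) y)) atTop
        (𝓝 (∫ y in (0 : ℝ)..h, v y * H (θ y))) := fun hv hv1 hH hB hHc =>
    tendsto_intervalIntegral_mul_comp hv hv1 hH hB hHc (fun n => (hθs _).measurable)
      (fun n => hθsab _) hθab (hlim.mono fun y hy => hy.comp hψ.tendsto_atTop)
      (fun n => ⟨(hs0' _).le, (hsI _).2⟩) hh.le hhlim
  have hval := conv hw hw1 (measurable_g θ0 κ) hC (continuousOn_g κ hθ0)
  have hlen := conv (v := fun _ => 1) measurable_const (by simp) (by fun_prop) hD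
    (continuousOn_one_div_sin hθ0)
  simp only [one_mul, hθsint] at hlen
  simp only [hθsval] at hval
  have hmax := tendsto_nhds_unique hval ((hu.comp hφ.tendsto_atTop).comp hψ.tendsto_atTop)
  refine ⟨h, θ, hh, hθ, hθab, tendsto_nhds_unique hlen tendsto_const_nhds, ?_⟩
  intro h' θ' hh' hθ' hθ'ab hint
  rw [hmax]
  exact le_csSup hbdd ⟨h', θ', hh', hθ', hθ'ab, hint, rfl⟩

end

/-- Existence of an optimal solution to problem (OP1), with the optimal control
non-increasing. -/
theorem op1_exists (θ0 κ ℓ : ℝ) (hθ0 : θ0 ∈ Set.Ioo 0 (π / 2)) (hκ : 0 < κ) (hℓ : 0 < ℓ)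
    (I : ℝ → ℝ) (hImono : MonotoneOn I (Set.Ici 0))
    (hIrange : ∀ y ∈ Set.Ici (0 : ℝ), I y ∈ Set.Icc (0 : ℝ) 1) :
    ∃ (h : ℝ) (θs : ℝ → ℝ), 0 < h ∧ Measurable θs ∧
      (∀ y ∈ Set.Icc 0 h, θs y ∈ Set.Icc θ0 (π / 2)) ∧
      (∫ y in (0 : ℝ)..h, 1 / Real.sin (θs y)) = ℓ ∧
      AntitoneOn θs (Set.Icc 0 h) ∧
      ∀ (h' : ℝ) (θ' : ℝ → ℝ), 0 < h' → Measurable θ' →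
        (∀ y ∈ Set.Icc 0 h', θ' y ∈ Set.Icc θ0 (π / 2)) →
        (∫ y in (0 : ℝ)..h', 1 / Real.sin (θ' y)) = ℓ →
        (∫ y in (0 : ℝ)..h', I y * g θ0 κ (θ' y)) ≤ ∫ y in (0 : ℝ)..h, I y * g θ0 κ (θs y) := by
  have hw : Monotone fun y => I (max y 0) := fun x y hxy =>
    hImono (le_max_right x 0) (le_max_right y 0) (max_le_max_right 0 hxy)
  have hw01 : ∀ y, I (max y 0) ∈ Set.Icc (0 : ℝ) 1 := fun y => hIrange _ (le_max_right y 0)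
  have hIw : ∀ {h : ℝ} (θ : ℝ → ℝ), 0 < h → (∫ y in (0 : ℝ)..h, I y * g θ0 κ (θ y)) =
      ∫ y in (0 : ℝ)..h, I (max y 0) * g θ0 κ (θ y) := fun {h} θ hh =>
    intervalIntegral.integral_congr fun y hy => by
      rw [Set.uIcc_of_le hh.le] at hy
      simp only [max_eq_left hy.1]
  obtain ⟨h, θ, hh, hθ, hθab, hint, hmax⟩ := exists_isGreatest_antitone (κ := κ) hθ0 hℓ
    hw.measurable fun y => abs_le.2 ⟨by linarith [(hw01 y).1], (hw01 y).2⟩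
  refine ⟨h, θ, hh, hθ.measurable, fun y _ => hθab y, hint, hθ.antitoneOn _, ?_⟩
  intro h' θ' hh' hθ' hθ'ab hint'
  obtain ⟨F, hF, hFab, hFint, hle⟩ := exists_antitone_ge hθ0 hκ hh'.le hw hw01 hθ' hθ'ab
  rw [hIw θ' hh', hIw θ hh]
  exact hle.trans (hmax h' F hh' hF hFab (hFint.trans hint'))
end

section
/- Let G(θ) = (1 − exp(−κ/cos(θ−θ0)))·cos(θ−θ0) and F(θ) = G'(θ)·tan θ − G(θ). Then for every z ∈ (−∞, e^{−κ}−1], the equation F(θ) = z has a unique solution θ = φ(z) in the interval [θ0, π/2). -/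
open Real

/-- `G(θ) = (1 − e^{−κ/cos(θ−θ0)})·cos(θ−θ0)`. -/
noncomputable def G (θ0 κ θ : ℝ) : ℝ :=
  (1 - Real.exp (-κ / Real.cos (θ - θ0))) * Real.cos (θ - θ0)

/-- `F(θ) = G'(θ)·tan θ − G(θ)`. -/
noncomputable def F (θ0 κ θ : ℝ) : ℝ :=
  deriv (G θ0 κ) θ * Real.tan θ - G θ0 κ θ

/-- The closed form of the derivative of `G`, valid where `cos (θ - θ0) ≠ 0`. -/
noncomputable def derivG (θ0 κ θ : ℝ) : ℝ :=
  -(Real.sin (θ - θ0) *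
    (1 - (1 + κ / Real.cos (θ - θ0)) * Real.exp (-κ / Real.cos (θ - θ0))))

lemma hasDerivAt_cos_sub (θ0 x : ℝ) :
    HasDerivAt (fun θ => Real.cos (θ - θ0)) (-Real.sin (x - θ0)) x := by
  simpa using ((hasDerivAt_id x).sub_const θ0).cos

lemma hasDerivAt_exp_neg_div_cos_sub {θ0 x : ℝ} (κ : ℝ) (hc : Real.cos (x - θ0) ≠ 0) :
    HasDerivAt (fun θ => Real.exp (-κ / Real.cos (θ - θ0)))
      (Real.exp (-κ / Real.cos (x - θ0)) *
        (-κ * Real.sin (x - θ0) / Real.cos (x - θ0) ^ 2)) x := by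
  have h := ((hasDerivAt_const x (-κ)).div (hasDerivAt_cos_sub θ0 x) hc).exp
  refine h.congr_deriv ?_
  simp

lemma hasDerivAt_G {θ0 x : ℝ} (κ : ℝ) (hc : Real.cos (x - θ0) ≠ 0) :
    HasDerivAt (G θ0 κ) (derivG θ0 κ x) x := by
  have h := ((hasDerivAt_exp_neg_div_cos_sub κ hc).const_sub 1).mul (hasDerivAt_cos_sub θ0 x)
  refine h.congr_deriv ?_
  unfold derivG
  field_simp
  ring

lemma hasDerivAt_derivG {θ0 x : ℝ} (κ : ℝ) (hc : Real.cos (x - θ0) ≠ 0) :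
    HasDerivAt (derivG θ0 κ)
      (-(Real.cos (x - θ0) *
          (1 - (1 + κ / Real.cos (x - θ0)) * Real.exp (-κ / Real.cos (x - θ0))) +
        Real.sin (x - θ0) ^ 2 * κ ^ 2 / Real.cos (x - θ0) ^ 3 *
          Real.exp (-κ / Real.cos (x - θ0)))) x := by
  have hs : HasDerivAt (fun θ => Real.sin (θ - θ0)) (Real.cos (x - θ0)) x := by
    simpa using ((hasDerivAt_id x).sub_const θ0).sin
  have hq := ((hasDerivAt_const x κ).div (hasDerivAt_cos_sub θ0 x) hc).const_add 1
  have h := (hs.mul ((hq.mul (hasDerivAt_exp_neg_div_cos_sub κ hc)).const_sub 1)).neg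
  refine h.congr_deriv ?_
  simp only [Pi.div_apply, Pi.mul_apply]
  field_simp
  ring

lemma one_sub_one_add_mul_exp_neg_pos {u : ℝ} (hu : 0 < u) :
    0 < 1 - (1 + u) * Real.exp (-u) := by
  have h1 : 1 + u < Real.exp u := by linarith [Real.add_one_lt_exp hu.ne']
  have h2 : Real.exp u * Real.exp (-u) = 1 := by rw [← Real.exp_add]; simp
  nlinarith [Real.exp_pos (-u)]

lemma F_eq {θ0 x : ℝ} (κ : ℝ) (hc : Real.cos (x - θ0) ≠ 0) :
    F θ0 κ x = derivG θ0 κ x * Real.tan x - G θ0 κ x := by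
  rw [F, (hasDerivAt_G κ hc).deriv]

lemma cos_sub_pos_of_mem_Icc {θ0 x : ℝ} (hθ0 : 0 < θ0) (hx : x ∈ Set.Icc θ0 (π / 2)) :
    0 < Real.cos (x - θ0) :=
  Real.cos_pos_of_mem_Ioo ⟨by linarith [hx.1, Real.pi_pos], by linarith [hx.2]⟩

lemma derivG_neg {θ0 κ x : ℝ} (hθ0 : 0 < θ0) (hκ : 0 < κ) (hx : x ∈ Set.Ioc θ0 (π / 2)) :
    derivG θ0 κ x < 0 := by
  have hc := cos_sub_pos_of_mem_Icc hθ0 (Set.Ioc_subset_Icc_self hx)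
  have hs : 0 < Real.sin (x - θ0) :=
    Real.sin_pos_of_pos_of_lt_pi (by linarith [hx.1]) (by linarith [hx.2, Real.pi_pos])
  have hp := one_sub_one_add_mul_exp_neg_pos (div_pos hκ hc)
  rw [← neg_div] at hp
  exact neg_neg_of_pos (mul_pos hs hp)

lemma hasDerivAt_derivG_mul_tan_sub_G {θ0 κ x D : ℝ} (hc : Real.cos (x - θ0) ≠ 0)
    (hx : Real.cos x ≠ 0) (hD : HasDerivAt (derivG θ0 κ) D x) :
    HasDerivAt (fun θ => derivG θ0 κ θ * Real.tan θ - G θ0 κ θ)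
      (Real.tan x * (D + derivG θ0 κ x * Real.tan x)) x := by
  refine ((hD.mul (Real.hasDerivAt_tan hx)).sub (hasDerivAt_G κ hc)).congr_deriv ?_
  have h : 1 / Real.cos x ^ 2 = 1 + Real.tan x ^ 2 := by
    rw [← Real.inv_one_add_tan_sq hx]; simp
  rw [h]
  ring

lemma continuousOn_F {θ0 : ℝ} (κ : ℝ) (hθ0 : 0 < θ0) :
    ContinuousOn (F θ0 κ) (Set.Ico θ0 (π / 2)) := by
  have hc : ∀ x ∈ Set.Ico θ0 (π / 2), Real.cos (x - θ0) ≠ 0 := fun x hx =>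
    (cos_sub_pos_of_mem_Icc hθ0 (Set.Ico_subset_Icc_self hx)).ne'
  refine ContinuousOn.congr (fun x hx => ?_) fun x hx => F_eq κ (hc x hx)
  have hx' : Real.cos x ≠ 0 :=
    (Real.cos_pos_of_mem_Ioo ⟨by linarith [hx.1, Real.pi_pos], hx.2⟩).ne'
  exact (hasDerivAt_derivG_mul_tan_sub_G (hc x hx) hx'
    (hasDerivAt_derivG κ (hc x hx))).continuousAt.continuousWithinAt

lemma strictAntiOn_F {θ0 κ : ℝ} (hθ0 : 0 < θ0) (hκ : 0 < κ) :
    StrictAntiOn (F θ0 κ) (Set.Ico θ0 (π / 2)) := by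
  refine strictAntiOn_of_deriv_neg (convex_Ico _ _) (continuousOn_F κ hθ0) fun x hx => ?_
  rw [interior_Ico] at hx
  have hc := cos_sub_pos_of_mem_Icc hθ0 (Set.Ioo_subset_Icc_self hx)
  have hx' : 0 < Real.cos x :=
    Real.cos_pos_of_mem_Ioo ⟨by linarith [hx.1, Real.pi_pos], hx.2⟩
  have ht : 0 < Real.tan x := Real.tan_pos_of_pos_of_lt_pi_div_two (hθ0.trans hx.1) hx.2
  have hF : F θ0 κ =ᶠ[nhds x] fun θ => derivG θ0 κ θ * Real.tan θ - G θ0 κ θ := by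
    filter_upwards [Ioo_mem_nhds hx.1 hx.2] with y hy
    exact F_eq κ (cos_sub_pos_of_mem_Icc hθ0 (Set.Ioo_subset_Icc_self hy)).ne'
  rw [hF.deriv_eq, (hasDerivAt_derivG_mul_tan_sub_G hc.ne' hx'.ne'
    (hasDerivAt_derivG κ hc.ne')).deriv]
  have hp := one_sub_one_add_mul_exp_neg_pos (div_pos hκ hc)
  rw [← neg_div] at hp
  refine mul_neg_of_pos_of_neg ht (add_neg (neg_neg_of_pos ?_)
    (mul_neg_of_neg_of_pos (derivG_neg hθ0 hκ (Set.Ioo_subset_Ioc_self hx)) ht))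
  positivity

lemma tendsto_F_atBot {θ0 κ : ℝ} (hθ0 : θ0 ∈ Set.Ioo 0 (π / 2)) (hκ : 0 < κ) :
    Filter.Tendsto (F θ0 κ) (nhdsWithin (π / 2) (Set.Iio (π / 2))) Filter.atBot := by
  have hc := (cos_sub_pos_of_mem_Icc hθ0.1 (Set.right_mem_Icc.2 hθ0.2.le)).ne'
  have hD := (hasDerivAt_derivG κ hc).continuousAt.tendsto.mono_left
    (nhdsWithin_le_nhds (s := Set.Iio (π / 2)))
  have hG := (hasDerivAt_G κ hc).continuousAt.tendsto.mono_left
    (nhdsWithin_le_nhds (s := Set.Iio (π / 2)))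
  have h := (hD.neg_mul_atTop (derivG_neg hθ0.1 hκ (Set.right_mem_Ioc.2 hθ0.2))
    Real.tendsto_tan_pi_div_two).atBot_add hG.neg
  refine h.congr' ?_
  filter_upwards [Ioo_mem_nhdsLT hθ0.2] with y hy
  rw [F_eq κ (cos_sub_pos_of_mem_Icc hθ0.1 (Set.Ioo_subset_Icc_self hy)).ne', sub_eq_add_neg]

lemma F_self (θ0 κ : ℝ) : F θ0 κ θ0 = Real.exp (-κ) - 1 := by
  rw [F_eq κ (by simp)]
  simp [derivG, G]

/-- For every `z ≤ e^{−κ} − 1` the equation `F(θ) = z` has a unique solution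
`θ ∈ [θ0, π/2)`. -/
theorem F_eq_unique_solution (θ0 κ : ℝ) (hθ0 : θ0 ∈ Set.Ioo 0 (π / 2)) (hκ : 0 < κ) :
    ∀ z ≤ Real.exp (-κ) - 1, ∃! θ, θ ∈ Set.Ico θ0 (π / 2) ∧ F θ0 κ θ = z := by
  intro z hz
  obtain ⟨b, hbz, hb⟩ := (((tendsto_F_atBot hθ0 hκ).eventually_le_atBot z).and
    (Ioo_mem_nhdsLT hθ0.2)).exists
  obtain ⟨θ, hθ, hθz⟩ := intermediate_value_Icc' hb.1.le
    ((continuousOn_F κ hθ0.1).mono (Set.Icc_subset_Ico_right hb.2))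
    ⟨hbz, hz.trans_eq (F_self θ0 κ).symm⟩
  have hθ' : θ ∈ Set.Ico θ0 (π / 2) := ⟨hθ.1, hθ.2.trans_lt hb.2⟩
  exact ⟨θ, ⟨hθ', hθz⟩, fun y hy =>
    (strictAntiOn_F hθ0.1 hκ).injOn hy.1 hθ' (hy.2.trans hθz.symm)⟩
end

section
/- The function g(θ) = (1 − exp(−κ/cos(θ−θ0)))·cos(θ−θ0)/sin θ satisfies g'(θ) ≤ 0 for all θ ∈ [θ0, π/2], i.e. g is non-increasing on [θ0, π/2]. -/
open Real

theorem one_add_mul_exp_neg_le_one (u : ℝ) : (1 + u) * Real.exp (-u) ≤ 1 := by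
  calc (1 + u) * Real.exp (-u) ≤ Real.exp u * Real.exp (-u) := by
        gcongr
        linarith [Real.add_one_le_exp u]
    _ = 1 := by rw [← Real.exp_add, add_neg_cancel, Real.exp_zero]

theorem hasDerivAt_g {θ0 κ θ : ℝ} (hc : Real.cos (θ - θ0) ≠ 0) (hs : Real.sin θ ≠ 0) :
    HasDerivAt (g θ0 κ)
      ((Real.sin (θ - θ0) * ((1 + κ / Real.cos (θ - θ0)) *
          Real.exp (-(κ / Real.cos (θ - θ0))) - 1) * Real.sin θ -
        (1 - Real.exp (-(κ / Real.cos (θ - θ0)))) * Real.cos (θ - θ0) * Real.cos θ) /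
        Real.sin θ ^ 2) θ := by
  have hcos : HasDerivAt (fun x => Real.cos (x - θ0)) (-Real.sin (θ - θ0)) θ := by
    simpa using ((hasDerivAt_id θ).sub_const θ0).cos
  have hexp := ((hasDerivAt_const θ (-κ)).fun_div hcos hc).exp
  have h := ((hexp.const_sub 1).fun_mul hcos).fun_div (Real.hasDerivAt_sin θ) hs
  refine HasDerivAt.congr_deriv h ?_
  rw [neg_div]
  field_simp
  ring

/-- `g' ≤ 0` on `[θ0, π/2]`, i.e. `g` is non-increasing there. -/
theorem g_antitone (θ0 κ : ℝ) (hθ0 : θ0 ∈ Set.Ioo 0 (π / 2)) (hκ : 0 < κ) :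
    (∀ θ ∈ Set.Icc θ0 (π / 2), deriv (g θ0 κ) θ ≤ 0) ∧
    AntitoneOn (g θ0 κ) (Set.Icc θ0 (π / 2)) := by
  obtain ⟨h0, h1⟩ := hθ0
  have hcos : ∀ θ ∈ Set.Icc θ0 (π / 2), 0 < Real.cos (θ - θ0) := fun θ hθ =>
    Real.cos_pos_of_mem_Ioo ⟨by linarith [hθ.1], by linarith [hθ.2]⟩
  have hsin : ∀ θ ∈ Set.Icc θ0 (π / 2), 0 < Real.sin θ := fun θ hθ =>
    Real.sin_pos_of_pos_of_lt_pi (by linarith [hθ.1]) (by linarith [hθ.2])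
  have hderiv : ∀ θ ∈ Set.Icc θ0 (π / 2), deriv (g θ0 κ) θ ≤ 0 := by
    intro θ hθ
    have hc := hcos θ hθ
    have hs := hsin θ hθ
    rw [(hasDerivAt_g hc.ne' hs.ne').deriv]
    have hC : 0 ≤ Real.cos θ :=
      Real.cos_nonneg_of_mem_Icc ⟨by linarith [hθ.1], hθ.2⟩
    have hS : 0 ≤ Real.sin (θ - θ0) :=
      Real.sin_nonneg_of_nonneg_of_le_pi (by linarith [hθ.1]) (by linarith [hθ.2])
    have hE : Real.exp (-(κ / Real.cos (θ - θ0))) ≤ 1 :=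
      Real.exp_le_one_iff.2 (neg_nonpos.2 (by positivity))
    have hu := one_add_mul_exp_neg_le_one (κ / Real.cos (θ - θ0))
    refine div_nonpos_of_nonpos_of_nonneg (sub_nonpos.2 ?_) (sq_nonneg _)
    exact (mul_nonpos_of_nonpos_of_nonneg
      (mul_nonpos_of_nonneg_of_nonpos hS (sub_nonpos.2 hu)) hs.le).trans
      (mul_nonneg (mul_nonneg (sub_nonneg.2 hE) hc.le) hC)
  refine ⟨hderiv, antitoneOn_of_deriv_nonpos (convex_Icc _ _) ?_ ?_ ?_⟩
  · exact fun θ hθ =>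
      (hasDerivAt_g (hcos θ hθ).ne' (hsin θ hθ).ne').continuousAt.continuousWithinAt
  · exact fun θ hθ =>
      (hasDerivAt_g (hcos θ (interior_subset hθ)).ne'
        (hsin θ (interior_subset hθ)).ne').differentiableAt.differentiableWithinAt
  · exact fun θ hθ => hderiv θ (interior_subset hθ)
end

section
/- For any bounded, nondecreasing function I:[0,∞)→[0,1] and any constants 0<α<1, c>0 and θ0∈(0,π/2), the optimization problem (OP2) has at least one solution: there exist measurable controls θ*:[0,∞)→[θ0,π/2] and u*:[0,∞)→[0,∞) maximizing the payoff ∫₀^∞ [I(y(t))·G(θ(t),u(t)) − c·z(t)^α] dt among all admissible controls, where y(t)=∫₀ᵗ sin θ(s) ds and z(t)=∫ₜ^∞ u(s) ds. -/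
open Real MeasureTheory

/-- `G(θ,u) = (1 − e^{−u/cos(θ−θ0)})·cos(θ−θ0)`. -/
noncomputable def G2 (θ0 θ u : ℝ) : ℝ :=
  (1 - Real.exp (-u / Real.cos (θ - θ0))) * Real.cos (θ - θ0)

/-- Admissible controls for problem (OP2). -/
def Adm2 (θ0 : ℝ) (θ u : ℝ → ℝ) : Prop :=
  Measurable θ ∧ Measurable u ∧
    (∀ t, θ t ∈ Set.Icc θ0 (π / 2)) ∧ (∀ t, 0 ≤ u t) ∧ IntegrableOn u (Set.Ioi 0)

/-- The payoff of (OP2): `∫₀^∞ [I(y(t))·G(θ(t),u(t)) − c·z(t)^α] dt`, with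
`y(t) = ∫₀ᵗ sin θ` and `z(t) = ∫ₜ^∞ u`. -/
noncomputable def Payoff (θ0 α c : ℝ) (I : ℝ → ℝ) (θ u : ℝ → ℝ) : ℝ :=
  ∫ t in Set.Ioi (0 : ℝ),
    (I (∫ s in (0 : ℝ)..t, Real.sin (θ s)) * G2 θ0 (θ t) (u t) -
      c * (∫ s in Set.Ioi t, u s) ^ α)

section WeakConvergence

open Real MeasureTheory Set Filter Topology

/-- Bounded sequences in a separable real Hilbert space have weakly convergent subsequences. -/
lemma exists_subseq_tendsto_inner {E : Type*} [NormedAddCommGroup E] [InnerProductSpace ℝ E]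
    [CompleteSpace E] [TopologicalSpace.SeparableSpace E] (x : ℕ → E) (C : ℝ)
    (hx : ∀ n, ‖x n‖ ≤ C) :
    ∃ (a : E) (φ : ℕ → ℕ), StrictMono φ ∧
      ∀ y, Tendsto (fun n => inner ℝ (x (φ n)) y) atTop (𝓝 (inner ℝ a y)) := by
  have hc := WeakDual.isSeqCompact_closedBall ℝ E 0 C
  let X : ℕ → WeakDual ℝ E := fun n =>
    StrongDual.toWeakDual (InnerProductSpace.toDual ℝ E (x n))
  have hX : ∀ n, X n ∈ WeakDual.toStrongDual ⁻¹' Metric.closedBall (0 : StrongDual ℝ E) C := by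
    intro n
    simp only [mem_preimage, mem_closedBall_zero_iff]
    change ‖InnerProductSpace.toDual ℝ E (x n)‖ ≤ C
    simpa using hx n
  obtain ⟨a, -, φ, hφ, hlim⟩ := hc hX
  refine ⟨(InnerProductSpace.toDual ℝ E).symm (WeakDual.toStrongDual a), φ, hφ, fun y => ?_⟩
  rw [InnerProductSpace.toDual_symm_apply]
  exact ((WeakDual.eval_continuous y).tendsto a).comp hlim

/-- `F n` converges to `f` weakly in `L¹((0, R])` for every `R`. -/
structure WeakTo (F : ℕ → ℝ → ℝ) (f : ℝ → ℝ) : Prop where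
  integrableOn_lim : ∀ R, IntegrableOn f (Ioc 0 R)
  integrableOn : ∀ n R, IntegrableOn (F n) (Ioc 0 R)
  tendsto : ∀ R (g : ℝ → ℝ), Measurable g → (∃ C, ∀ t, |g t| ≤ C) →
    Tendsto (fun n => ∫ t in Ioc 0 R, g t * F n t) atTop (𝓝 (∫ t in Ioc 0 R, g t * f t))

namespace WeakTo

variable {F F' : ℕ → ℝ → ℝ} {f f' : ℝ → ℝ}

lemma comp (h : WeakTo F f) {φ : ℕ → ℕ} (hφ : StrictMono φ) : WeakTo (fun n => F (φ n)) f :=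
  ⟨h.integrableOn_lim, fun _ => h.integrableOn _, fun R g hg hb =>
    (h.tendsto R g hg hb).comp hφ.tendsto_atTop⟩

lemma bdd_mul (h : WeakTo F f) {g : ℝ → ℝ} (hg : Measurable g) (hb : ∃ C, ∀ t, |g t| ≤ C) :
    WeakTo (fun n t => g t * F n t) (fun t => g t * f t) := by
  obtain ⟨C, hC⟩ := hb
  refine ⟨fun R => ?_, fun n R => ?_, fun R k hk hkb => ?_⟩
  · exact (h.integrableOn_lim R).bdd_mul hg.aestronglyMeasurable (ae_of_all _ hC)
  · exact (h.integrableOn n R).bdd_mul hg.aestronglyMeasurable (ae_of_all _ hC)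
  · obtain ⟨D, hD⟩ := hkb
    have := h.tendsto R (fun t => k t * g t) (hk.mul hg) ⟨D * C, fun t => by
      rw [abs_mul]
      exact mul_le_mul (hD t) (hC t) (abs_nonneg _) ((abs_nonneg _).trans (hD t))⟩
    simpa only [mul_assoc] using this

lemma add (h : WeakTo F f) (h' : WeakTo F' f') :
    WeakTo (fun n t => F n t + F' n t) (fun t => f t + f' t) := by
  refine ⟨fun R => (h.integrableOn_lim R).add (h'.integrableOn_lim R),
    fun n R => (h.integrableOn n R).add (h'.integrableOn n R), fun R k hk hkb => ?_⟩
  have key := (h.tendsto R k hk hkb).add (h'.tendsto R k hk hkb)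
  obtain ⟨D, hD⟩ := hkb
  have I : ∀ {q : ℝ → ℝ}, IntegrableOn q (Ioc 0 R) →
      Integrable (fun t => k t * q t) (volume.restrict (Ioc 0 R)) := fun hq =>
    Integrable.bdd_mul hq hk.aestronglyMeasurable (ae_of_all _ hD)
  simp only [mul_add]
  rw [integral_add (I (h.integrableOn_lim R)) (I (h'.integrableOn_lim R))]
  refine key.congr fun n => ?_
  rw [integral_add (I (h.integrableOn n R)) (I (h'.integrableOn n R))]

lemma tendsto_setIntegral (h : WeakTo F f) (R : ℝ) {s : Set ℝ} (hs : MeasurableSet s)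
    (hsR : s ⊆ Ioc 0 R) :
    Tendsto (fun n => ∫ t in s, F n t) atTop (𝓝 (∫ t in s, f t)) := by
  have key := h.tendsto R (s.indicator fun _ => 1) (measurable_const.indicator hs)
    ⟨1, fun t => by by_cases ht : t ∈ s <;> simp [ht]⟩
  have e : ∀ q : ℝ → ℝ, ∫ t in Ioc 0 R, s.indicator (fun _ => (1 : ℝ)) t * q t
      = ∫ t in s, q t := by
    intro q
    have hi : ∫ t in s, q t = ∫ t in Ioc 0 R ∩ s, q t := by
      rw [inter_eq_self_of_subset_right hsR]
    rw [hi, ← setIntegral_indicator hs]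
    congr 1
    ext t
    by_cases ht : t ∈ s <;> simp [ht]
  simpa only [e] using key

lemma ae_le (h : WeakTo F f) {r : ℝ → ℝ} (hr : Measurable r) (hb : ∃ C, ∀ t, |r t| ≤ C)
    (hle : ∀ n t, F n t ≤ r t) : ∀ᵐ t ∂volume.restrict (Ioi (0 : ℝ)), f t ≤ r t := by
  obtain ⟨C, hC⟩ := hb
  have hU : Ioi (0 : ℝ) = ⋃ k : ℕ, Ioc (0 : ℝ) k := by
    ext t
    simp only [mem_Ioi, mem_iUnion, mem_Ioc]
    exact ⟨fun ht => (exists_nat_ge t).imp fun k hk => ⟨ht, hk⟩, fun ⟨_, ht, _⟩ => ht⟩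
  rw [hU, ae_restrict_iUnion_iff]
  intro k
  have hri : IntegrableOn r (Ioc (0 : ℝ) k) :=
    Integrable.of_bound hr.aestronglyMeasurable C (ae_of_all _ hC)
  refine ae_le_of_forall_setIntegral_le (h.integrableOn_lim k) hri fun s hs _ => ?_
  rw [Measure.restrict_restrict hs]
  have hsub : s ∩ Ioc (0 : ℝ) k ⊆ Ioc (0 : ℝ) k := inter_subset_right
  refine le_of_tendsto (h.tendsto_setIntegral k (hs.inter measurableSet_Ioc) hsub)
    (Eventually.of_forall fun n => ?_)
  exact setIntegral_mono ((h.integrableOn n k).mono_set hsub) (hri.mono_set hsub) (hle n)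

end WeakTo

lemma exists_weakTo_subseq {H : ℝ → ℝ}
    (hH : MemLp (fun t => H t * exp (-t)) 2 (volume.restrict (Ioi 0)))
    {F : ℕ → ℝ → ℝ} (hF : ∀ n, Measurable (F n)) (hle : ∀ n, ∀ t > 0, |F n t| ≤ H t) :
    ∃ (f : ℝ → ℝ) (φ : ℕ → ℕ), Measurable f ∧ StrictMono φ ∧ WeakTo (fun n => F (φ n)) f := by
  set ν := volume.restrict (Ioi (0 : ℝ)) with hν
  have hm : Measurable fun t : ℝ => exp (-t) := by fun_prop
  have hdom : ∀ n, ∀ᵐ t ∂ν, ‖F n t * exp (-t)‖ ≤ ‖H t * exp (-t)‖ := fun n => by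
    filter_upwards [ae_restrict_mem measurableSet_Ioi] with t ht
    rw [norm_mul, norm_mul]
    gcongr
    exact (hle n t ht).trans (le_abs_self _)
  have hL : ∀ n, MemLp (fun t => F n t * exp (-t)) 2 ν := fun n =>
    hH.of_le ((hF n).mul hm).aestronglyMeasurable (hdom n)
  have : Fact ((2 : ENNReal) ≠ ⊤) := ⟨by norm_num⟩
  obtain ⟨a, φ, hφ, hlim⟩ := exists_subseq_tendsto_inner (fun n => (hL n).toLp _) ‖hH.toLp _‖
    (fun n => Lp.norm_le_norm_of_ae_le (by
      filter_upwards [(hL n).coeFn_toLp, hH.coeFn_toLp, hdom n] with t h1 h2 h3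
      rwa [h1, h2]))
  have ham : Measurable a := (Lp.stronglyMeasurable a).measurable
  have hsub : ∀ R : ℝ, Ioc (0 : ℝ) R ⊆ Ioi 0 := fun R => Ioc_subset_Ioi_self
  have hν' : ∀ R : ℝ, ν.restrict (Ioc 0 R) = volume.restrict (Ioc 0 R) := fun R => by
    rw [hν, Measure.restrict_restrict measurableSet_Ioc, inter_eq_self_of_subset_left (hsub R)]
  -- multiplication by the test weight stays in `L²`
  have hint : ∀ (q : ℝ → ℝ), Measurable q → MemLp (fun t => q t * exp (-t)) 2 ν →
      ∀ R, IntegrableOn q (Ioc 0 R) := by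
    intro q hq hq2 R
    have h1 : MemLp (fun t => q t * exp (-t)) 2 (volume.restrict (Ioc 0 R)) :=
      hν' R ▸ hq2.restrict _
    have h2 : Integrable (fun t => q t * exp (-t)) (volume.restrict (Ioc 0 R)) :=
      h1.integrable (by norm_num)
    refine ((h2.norm.const_mul (exp R))).mono' hq.aestronglyMeasurable ?_
    filter_upwards [ae_restrict_mem measurableSet_Ioc] with t ht
    rw [norm_mul, norm_eq_abs (exp _), abs_exp, mul_left_comm, ← exp_add]
    exact le_mul_of_one_le_right (norm_nonneg _) (one_le_exp (by linarith [ht.2]))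
  have haeq : (fun t => a t * exp t * exp (-t)) = a := by
    ext t
    rw [mul_assoc, ← exp_add]
    simp
  refine ⟨fun t => a t * exp t, φ, ham.mul measurable_exp, hφ, fun R => ?_, fun n R => ?_,
    fun R g hg hgb => ?_⟩
  · exact hint (fun t => a t * exp t) (ham.mul measurable_exp) (by rw [haeq]; exact Lp.memLp a) R
  · exact hint _ (hF _) (hL _) R
  · obtain ⟨C, hC⟩ := hgb
    set k : ℝ → ℝ := (Ioc 0 R).indicator fun t => g t * exp t with hk
    have hkm : Measurable k := (hg.mul measurable_exp).indicator measurableSet_Ioc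
    have hk2 : MemLp k 2 ν := by
      rw [hk, memLp_indicator_iff_restrict measurableSet_Ioc, hν']
      refine MemLp.of_bound (hg.mul measurable_exp).aestronglyMeasurable (C * exp R) ?_
      filter_upwards [ae_restrict_mem measurableSet_Ioc] with t ht
      rw [norm_mul, norm_eq_abs (exp _), abs_exp]
      exact mul_le_mul (hC t) (exp_le_exp.2 ht.2) (exp_nonneg _) ((abs_nonneg _).trans (hC t))
    have hpair : ∀ (q : ℝ → ℝ) (b : Lp ℝ 2 ν), (b =ᵐ[ν] fun t => q t * exp (-t)) →
        inner ℝ b (hk2.toLp k) = ∫ t in Ioc 0 R, g t * q t := by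
      intro q b hb
      rw [L2.inner_def, ← hν' R, ← integral_indicator measurableSet_Ioc]
      refine integral_congr_ae ?_
      filter_upwards [hb, hk2.coeFn_toLp] with t h1 h2
      rw [h1, h2]
      by_cases ht : t ∈ Ioc 0 R
      · simp only [hk, indicator_of_mem ht, RCLike.inner_apply, conj_trivial]
        rw [show g t * exp t * (q t * exp (-t)) = g t * q t * (exp t * exp (-t)) by ring,
          ← exp_add]
        simp
      · simp [hk, indicator_of_notMem ht]
    have := hlim (hk2.toLp k)
    rw [hpair (fun t => a t * exp t) a (by rw [haeq])] at this
    refine this.congr fun n => ?_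
    exact hpair (F (φ n)) _ (hL (φ n)).coeFn_toLp

end WeakConvergence

section Controls

open Real MeasureTheory Set Filter Topology

variable {θ0 θ u x α c : ℝ}

lemma cos_sub_pos_of_mem (hθ0 : θ0 ∈ Ioo 0 (π / 2)) (hθ : θ ∈ Icc θ0 (π / 2)) :
    0 < cos (θ - θ0) :=
  cos_pos_of_mem_Ioo ⟨by linarith [hθ.1, pi_pos], by linarith [hθ.2, hθ0.1]⟩

lemma G2_le_affine (hw : 0 < cos (θ - θ0)) (u x : ℝ) :
    G2 θ0 θ u ≤ (1 - exp (-x) - x * exp (-x)) * cos (θ - θ0) + exp (-x) * u := by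
  unfold G2
  set w := cos (θ - θ0)
  have h1 : exp (-x) * (x - u / w + 1) ≤ exp (-u / w) := by
    have := add_one_le_exp (x - u / w)
    calc exp (-x) * (x - u / w + 1) ≤ exp (-x) * exp (x - u / w) := by gcongr
      _ = exp (-u / w) := by rw [← exp_add]; ring_nf
  have h2 := mul_le_mul_of_nonneg_right h1 hw.le
  have h3 : exp (-x) * (x - u / w + 1) * w = exp (-x) * (x * w - u + w) := by
    field_simp
  nlinarith

lemma G2_eq_affine (hw : 0 < cos (θ - θ0)) (u : ℝ) :
    G2 θ0 θ u = (1 - exp (-(u / cos (θ - θ0)))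
      - u / cos (θ - θ0) * exp (-(u / cos (θ - θ0)))) * cos (θ - θ0)
      + exp (-(u / cos (θ - θ0))) * u := by
  unfold G2
  rw [neg_div]
  field_simp
  ring

lemma one_sub_exp_sub_nonneg (x : ℝ) : 0 ≤ 1 - exp (-x) - x * exp (-x) := by
  have h := mul_le_mul_of_nonneg_left (add_one_le_exp x) (exp_nonneg (-x))
  rw [← exp_add, neg_add_cancel, exp_zero] at h
  linarith

lemma G2_nonneg (hw : 0 < cos (θ - θ0)) (hu : 0 ≤ u) : 0 ≤ G2 θ0 θ u := by
  unfold G2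
  refine mul_nonneg (sub_nonneg.2 (exp_le_one_iff.2 ?_)) hw.le
  rw [neg_div]
  exact neg_nonpos.2 (by positivity)

lemma G2_le_one (hw : 0 < cos (θ - θ0)) : G2 θ0 θ u ≤ 1 := by
  unfold G2
  nlinarith [exp_pos (-u / cos (θ - θ0)), cos_le_one (θ - θ0)]

lemma G2_le_self (hw : 0 < cos (θ - θ0)) : G2 θ0 θ u ≤ u := by
  simpa using G2_le_affine hw u 0

lemma G2_sub_min_le (hw : 0 < cos (θ - θ0)) {h : ℝ} (hh : 0 ≤ h) :
    G2 θ0 θ u - G2 θ0 θ (min u h) ≤ exp (-h) * (u - min u h) := by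
  rcases le_total u h with huh | huh
  · simp [min_eq_left huh]
  · rw [min_eq_right huh]
    have h1 := G2_le_affine hw u (h / cos (θ - θ0))
    have h2 := G2_eq_affine hw h
    have h3 : exp (-(h / cos (θ - θ0))) ≤ exp (-h) :=
      exp_le_exp.2 (neg_le_neg (le_div_self hh hw (cos_le_one _)))
    nlinarith [mul_le_mul_of_nonneg_right h3 (sub_nonneg.2 huh)]

lemma measurable_G2 {θ u : ℝ → ℝ} (hθ : Measurable θ) (hu : Measurable u) :
    Measurable fun t => G2 θ0 (θ t) (u t) := by
  unfold G2
  fun_prop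

/-- The tail `z(t) = ∫ₜ^∞ u`. -/
noncomputable def tail (u : ℝ → ℝ) (t : ℝ) : ℝ := ∫ s in Ioi t, u s

/-- The height `y(t) = ∫₀ᵗ sin θ`. -/
noncomputable def height (θ : ℝ → ℝ) (t : ℝ) : ℝ := ∫ s in (0 : ℝ)..t, sin (θ s)

lemma tail_nonneg {u : ℝ → ℝ} (hu : ∀ t, 0 ≤ u t) (t : ℝ) : 0 ≤ tail u t :=
  integral_nonneg hu

lemma tail_eq_add {u : ℝ → ℝ} (hui : IntegrableOn u (Ioi 0)) {s t : ℝ} (hs : 0 ≤ s)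
    (hst : s ≤ t) : tail u s = (∫ r in Ioc s t, u r) + tail u t := by
  unfold tail
  rw [← Ioc_union_Ioi_eq_Ioi hst]
  refine setIntegral_union (Ioc_disjoint_Ioi le_rfl) measurableSet_Ioi
    (hui.mono_set fun r hr => hs.trans_lt hr.1)
    (hui.mono_set (Ioi_subset_Ioi (hs.trans hst)))

lemma antitoneOn_tail {u : ℝ → ℝ} (hu : ∀ t, 0 ≤ u t) (hui : IntegrableOn u (Ioi 0)) :
    AntitoneOn (tail u) (Ici 0) := by
  intro s hs t _ hst
  rw [tail_eq_add hui hs hst]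
  exact le_add_of_nonneg_left (integral_nonneg hu)

lemma antitoneOn_tail_rpow {u : ℝ → ℝ} (hα : 0 ≤ α) (hu : ∀ t, 0 ≤ u t)
    (hui : IntegrableOn u (Ioi 0)) : AntitoneOn (fun t => tail u t ^ α) (Ici 0) :=
  fun _ hs _ ht hst =>
    rpow_le_rpow (tail_nonneg hu _) (antitoneOn_tail hu hui hs ht hst) hα

lemma aemeasurable_tail_rpow {u : ℝ → ℝ} (hα : 0 ≤ α) (hu : ∀ t, 0 ≤ u t)
    (hui : IntegrableOn u (Ioi 0)) :
    AEMeasurable (fun t => tail u t ^ α) (volume.restrict (Ioi 0)) :=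
  aemeasurable_restrict_of_antitoneOn measurableSet_Ioi
    ((antitoneOn_tail_rpow hα hu hui).mono Ioi_subset_Ici_self)

lemma intervalIntegrable_sin {θ : ℝ → ℝ} (hθ : Measurable θ) (a b : ℝ) :
    IntervalIntegrable (fun s => sin (θ s)) volume a b :=
  (intervalIntegrable_const (c := (1 : ℝ))).mono_fun
    (measurable_sin.comp hθ).aestronglyMeasurable
    (ae_of_all _ fun s => by simpa using abs_sin_le_one (θ s))

lemma continuous_height {θ : ℝ → ℝ} (hθ : Measurable θ) : Continuous (height θ) :=
  intervalIntegral.continuous_primitive (intervalIntegrable_sin hθ) 0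

variable {J : ℝ → ℝ}

lemma measurable_reward (hJ : Monotone J) {θ u : ℝ → ℝ} (hA : Adm2 θ0 θ u) :
    Measurable fun t => J (height θ t) * G2 θ0 (θ t) (u t) :=
  (hJ.measurable.comp (continuous_height hA.1).measurable).mul (measurable_G2 hA.1 hA.2.1)

lemma reward_nonneg (hθ0 : θ0 ∈ Ioo 0 (π / 2)) (hJr : ∀ y, J y ∈ Icc (0 : ℝ) 1)
    {θ u : ℝ → ℝ} (hA : Adm2 θ0 θ u) (t : ℝ) : 0 ≤ J (height θ t) * G2 θ0 (θ t) (u t) :=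
  mul_nonneg (hJr _).1 (G2_nonneg (cos_sub_pos_of_mem hθ0 (hA.2.2.1 t)) (hA.2.2.2.1 t))

lemma reward_le_one (hθ0 : θ0 ∈ Ioo 0 (π / 2)) (hJr : ∀ y, J y ∈ Icc (0 : ℝ) 1)
    {θ u : ℝ → ℝ} (hA : Adm2 θ0 θ u) (t : ℝ) : J (height θ t) * G2 θ0 (θ t) (u t) ≤ 1 :=
  mul_le_one₀ (hJr _).2 (G2_nonneg (cos_sub_pos_of_mem hθ0 (hA.2.2.1 t)) (hA.2.2.2.1 t))
    (G2_le_one (cos_sub_pos_of_mem hθ0 (hA.2.2.1 t)))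

lemma reward_le_self (hθ0 : θ0 ∈ Ioo 0 (π / 2)) (hJr : ∀ y, J y ∈ Icc (0 : ℝ) 1)
    {θ u : ℝ → ℝ} (hA : Adm2 θ0 θ u) (t : ℝ) : J (height θ t) * G2 θ0 (θ t) (u t) ≤ u t := by
  have hw := cos_sub_pos_of_mem hθ0 (hA.2.2.1 t)
  exact (mul_le_of_le_one_left (G2_nonneg hw (hA.2.2.2.1 t)) (hJr _).2).trans (G2_le_self hw)

lemma integrableOn_reward (hθ0 : θ0 ∈ Ioo 0 (π / 2)) (hJ : Monotone J)
    (hJr : ∀ y, J y ∈ Icc (0 : ℝ) 1) {θ u : ℝ → ℝ} (hA : Adm2 θ0 θ u) :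
    IntegrableOn (fun t => J (height θ t) * G2 θ0 (θ t) (u t)) (Ioi 0) :=
  Integrable.mono' hA.2.2.2.2 (measurable_reward hJ hA).aestronglyMeasurable
    (ae_of_all _ fun t => by
      rw [norm_of_nonneg (reward_nonneg hθ0 hJr hA t)]
      exact reward_le_self hθ0 hJr hA t)

lemma payoff_eq_sub (hθ0 : θ0 ∈ Ioo 0 (π / 2)) (hJ : Monotone J)
    (hJr : ∀ y, J y ∈ Icc (0 : ℝ) 1) {θ u : ℝ → ℝ} (hA : Adm2 θ0 θ u)
    (hz : IntegrableOn (fun t => tail u t ^ α) (Ioi 0)) :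
    Payoff θ0 α c J θ u = (∫ t in Ioi (0 : ℝ), J (height θ t) * G2 θ0 (θ t) (u t))
      - c * ∫ t in Ioi (0 : ℝ), tail u t ^ α := by
  rw [← integral_const_mul]
  exact integral_sub (integrableOn_reward hθ0 hJ hJr hA) (hz.const_mul c)

lemma integrableOn_tail_rpow_of_payoff_pos (hθ0 : θ0 ∈ Ioo 0 (π / 2)) (hc : 0 < c)
    (hJ : Monotone J) (hJr : ∀ y, J y ∈ Icc (0 : ℝ) 1) {θ u : ℝ → ℝ} (hA : Adm2 θ0 θ u)
    (hpos : 0 < Payoff θ0 α c J θ u) : IntegrableOn (fun t => tail u t ^ α) (Ioi 0) := by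
  have hi : IntegrableOn (fun t => J (height θ t) * G2 θ0 (θ t) (u t) - c * tail u t ^ α)
      (Ioi 0) := by
    by_contra h
    exact hpos.ne' (integral_undef h)
  have := ((integrableOn_reward hθ0 hJ hJr hA).sub hi).const_mul c⁻¹
  refine this.congr (ae_of_all _ fun t => ?_)
  simp only [Pi.sub_apply]
  field_simp
  ring

lemma mul_tail_rpow_le (hα : 0 ≤ α) {u : ℝ → ℝ} (hu : ∀ t, 0 ≤ u t)
    (hui : IntegrableOn u (Ioi 0)) (hz : IntegrableOn (fun t => tail u t ^ α) (Ioi 0))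
    {t : ℝ} (ht : 0 ≤ t) : t * tail u t ^ α ≤ ∫ s in Ioi (0 : ℝ), tail u s ^ α := by
  calc t * tail u t ^ α = ∫ _ in Ioc 0 t, tail u t ^ α := by simp [ht]
    _ ≤ ∫ s in Ioc 0 t, tail u s ^ α :=
      setIntegral_mono_on (integrableOn_const (by simp)) (hz.mono_set Ioc_subset_Ioi_self)
        measurableSet_Ioc fun s hs => antitoneOn_tail_rpow hα hu hui hs.1.le ht hs.2
    _ ≤ _ := setIntegral_mono_set hz (ae_of_all _ fun s => rpow_nonneg (tail_nonneg hu s) _)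
      Ioc_subset_Ioi_self.eventuallyLE

lemma integral_reward_le (hθ0 : θ0 ∈ Ioo 0 (π / 2)) (hJ : Monotone J)
    (hJr : ∀ y, J y ∈ Icc (0 : ℝ) 1) {θ u : ℝ → ℝ} (hA : Adm2 θ0 θ u) {T : ℝ} (hT : 0 ≤ T) :
    ∫ t in Ioi (0 : ℝ), J (height θ t) * G2 θ0 (θ t) (u t)
      ≤ (∫ t in Ioc 0 T, J (height θ t) * G2 θ0 (θ t) (u t)) + tail u T := by
  have hi := integrableOn_reward hθ0 hJ hJr hA
  have hs : Ioi T ⊆ Ioi 0 := Ioi_subset_Ioi hT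
  rw [← Ioc_union_Ioi_eq_Ioi hT, setIntegral_union (Ioc_disjoint_Ioi le_rfl) measurableSet_Ioi
    (hi.mono_set Ioc_subset_Ioi_self) (hi.mono_set hs)]
  exact add_le_add_right (setIntegral_mono (hi.mono_set hs) (hA.2.2.2.2.mono_set hs)
    (reward_le_self hθ0 hJr hA)) _

lemma integral_reward_le_half_cost (hθ0 : θ0 ∈ Ioo 0 (π / 2)) (hα : 0 < α) (hc : 0 < c)
    (hJ : Monotone J) (hJr : ∀ y, J y ∈ Icc (0 : ℝ) 1) {θ u : ℝ → ℝ} (hA : Adm2 θ0 θ u)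
    (hz : IntegrableOn (fun t => tail u t ^ α) (Ioi 0)) :
    ∫ t in Ioi (0 : ℝ), J (height θ t) * G2 θ0 (θ t) (u t)
      ≤ c / 2 * (∫ t in Ioi (0 : ℝ), tail u t ^ α) + (2 / c) ^ (1 / α) := by
  set Z := ∫ t in Ioi (0 : ℝ), tail u t ^ α with hZ
  have htn := tail_nonneg hA.2.2.2.1
  have hZ0 : 0 ≤ Z := integral_nonneg fun t => rpow_nonneg (htn t) _
  have hu := hA.2.2.2.1
  have hui := hA.2.2.2.2
  rcases hZ0.eq_or_lt with h0 | hZpos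
  · have hlim : ∀ T > (0 : ℝ), tail u T ≤ 0 := fun T hT => by
      have h1 : T * tail u T ^ α ≤ 0 := by
        simpa [← hZ, ← h0] using mul_tail_rpow_le hα.le hu hui hz hT.le
      by_contra! h2
      have := mul_pos hT (rpow_pos_of_pos h2 α)
      linarith
    rw [← h0, mul_zero, zero_add]
    refine le_of_forall_pos_le_add fun T hT => ?_
    refine (integral_reward_le hθ0 hJ hJr hA hT.le).trans ?_
    have h3 : ∫ t in Ioc 0 T, J (height θ t) * G2 θ0 (θ t) (u t) ≤ T := by
      calc _ ≤ ∫ t in Ioc 0 T, (1 : ℝ) := setIntegral_mono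
            ((integrableOn_reward hθ0 hJ hJr hA).mono_set Ioc_subset_Ioi_self)
            (integrableOn_const (by simp)) (reward_le_one hθ0 hJr hA)
        _ = T := by simp [hT.le]
    have : 0 ≤ (2 / c) ^ (1 / α) := by positivity
    linarith [hlim T hT]
  · have hT : 0 < c / 2 * Z := by positivity
    refine (integral_reward_le hθ0 hJ hJr hA hT.le).trans (add_le_add ?_ ?_)
    · calc _ ≤ ∫ t in Ioc 0 (c / 2 * Z), (1 : ℝ) := setIntegral_mono
            ((integrableOn_reward hθ0 hJ hJr hA).mono_set Ioc_subset_Ioi_self)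
            (integrableOn_const (by simp)) (reward_le_one hθ0 hJr hA)
        _ = c / 2 * Z := by simp [hT.le]
    · have h1 := mul_tail_rpow_le hα.le hu hui hz hT.le
      rw [← hZ] at h1
      have h2 : tail u (c / 2 * Z) ^ α ≤ 2 / c := by
        rw [le_div_iff₀ hc]
        have h3 : Z * (tail u (c / 2 * Z) ^ α * c) ≤ Z * 2 := by linarith
        exact le_of_mul_le_mul_left h3 hZpos
      calc tail u (c / 2 * Z) = (tail u (c / 2 * Z) ^ α) ^ (1 / α) := by
            rw [← rpow_mul (htn _), mul_one_div_cancel hα.ne', rpow_one]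
        _ ≤ _ := rpow_le_rpow (rpow_nonneg (htn _) _) h2 (by positivity)

end Controls

section Truncation

open Real MeasureTheory Set Filter Topology

lemma lintegral_mul_lintegral_Ioi {κ d : ℝ → ENNReal} (hκ : Measurable κ) (hd : Measurable d) :
    ∫⁻ t in Ioi 0, κ t * ∫⁻ s in Ioi t, d s = ∫⁻ s in Ioi 0, (∫⁻ t in Ioo 0 s, κ t) * d s := by
  let T : Set (ℝ × ℝ) := {q | q.1 < q.2}
  have hT : MeasurableSet T := measurableSet_lt measurable_fst measurable_snd
  have hm : Measurable (T.indicator fun q : ℝ × ℝ => κ q.1 * d q.2) :=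
    ((hκ.comp measurable_fst).mul (hd.comp measurable_snd)).indicator hT
  have h1 : ∀ t ∈ Ioi (0 : ℝ), κ t * ∫⁻ s in Ioi t, d s
      = ∫⁻ s in Ioi 0, T.indicator (fun q : ℝ × ℝ => κ q.1 * d q.2) (t, s) := by
    intro t ht
    rw [← lintegral_const_mul _ hd]
    have e : ∀ s, T.indicator (fun q : ℝ × ℝ => κ q.1 * d q.2) (t, s)
        = (Ioi t).indicator (fun s => κ t * d s) s := by
      intro s
      by_cases h : t < s <;> simp [T, h]
    simp_rw [e]
    rw [lintegral_indicator measurableSet_Ioi, Measure.restrict_restrict measurableSet_Ioi,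
      inter_eq_self_of_subset_left (Ioi_subset_Ioi (le_of_lt ht))]
  have h2 : ∀ s, (∫⁻ t in Ioo 0 s, κ t) * d s
      = ∫⁻ t in Ioi 0, T.indicator (fun q : ℝ × ℝ => κ q.1 * d q.2) (t, s) := by
    intro s
    rw [← lintegral_mul_const _ hκ]
    have e : ∀ t, T.indicator (fun q : ℝ × ℝ => κ q.1 * d q.2) (t, s)
        = (Iio s).indicator (fun t => κ t * d s) t := by
      intro t
      by_cases h : t < s <;> simp [T, h]
    simp_rw [e]
    rw [lintegral_indicator measurableSet_Iio, Measure.restrict_restrict measurableSet_Iio,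
      Iio_inter_Ioi]
  rw [setLIntegral_congr_fun measurableSet_Ioi h1]
  simp_rw [h2]
  exact lintegral_lintegral_swap hm.aemeasurable

lemma integral_mul_le_integral_of_mul_tail_le {κ ψ d q : ℝ → ℝ} (hκ : Measurable κ)
    (hκ0 : ∀ t > 0, 0 ≤ κ t) (hκi : ∀ s > 0, IntegrableOn κ (Ioo 0 s))
    (hψ : ∀ s > 0, ψ s ≤ ∫ t in Ioo 0 s, κ t) (hψ0 : ∀ s, 0 ≤ ψ s) (hd : Measurable d)
    (hd0 : ∀ t, 0 ≤ d t) (hdi : IntegrableOn d (Ioi 0))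
    (hψd : IntegrableOn (fun s => ψ s * d s) (Ioi 0)) (hq : IntegrableOn q (Ioi 0))
    (hle : ∀ t > 0, κ t * tail d t ≤ q t) :
    ∫ s in Ioi 0, ψ s * d s ≤ ∫ t in Ioi 0, q t := by
  have hq0 : ∀ t > 0, 0 ≤ q t := fun t ht =>
    (mul_nonneg (hκ0 t ht) (tail_nonneg hd0 t)).trans (hle t ht)
  have hqi : 0 ≤ ∫ t in Ioi 0, q t := setIntegral_nonneg measurableSet_Ioi hq0
  rw [← ENNReal.ofReal_le_ofReal_iff hqi,
    ofReal_integral_eq_lintegral_ofReal hψd (ae_of_all _ fun s => mul_nonneg (hψ0 s) (hd0 s)),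
    ofReal_integral_eq_lintegral_ofReal hq
      ((ae_restrict_mem measurableSet_Ioi).mono fun t ht => hq0 t ht)]
  calc ∫⁻ s in Ioi 0, ENNReal.ofReal (ψ s * d s)
      ≤ ∫⁻ s in Ioi 0, (∫⁻ t in Ioo 0 s, ENNReal.ofReal (κ t)) * ENNReal.ofReal (d s) := by
        refine setLIntegral_mono' measurableSet_Ioi fun s hs => ?_
        rw [ENNReal.ofReal_mul (hψ0 s)]
        gcongr
        rw [← ofReal_integral_eq_lintegral_ofReal (hκi s hs)
          ((ae_restrict_mem measurableSet_Ioo).mono fun t ht => hκ0 t ht.1)]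
        exact ENNReal.ofReal_le_ofReal (hψ s hs)
    _ = ∫⁻ t in Ioi 0, ENNReal.ofReal (κ t) * ∫⁻ s in Ioi t, ENNReal.ofReal (d s) :=
        (lintegral_mul_lintegral_Ioi hκ.ennreal_ofReal hd.ennreal_ofReal).symm
    _ ≤ ∫⁻ t in Ioi 0, ENNReal.ofReal (q t) := by
        refine setLIntegral_mono' measurableSet_Ioi fun t ht => ?_
        rw [← ofReal_integral_eq_lintegral_ofReal
          (hdi.mono_set (Ioi_subset_Ioi (le_of_lt ht))) (ae_of_all _ hd0),
          ← ENNReal.ofReal_mul (hκ0 t ht)]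
        exact ENNReal.ofReal_le_ofReal (hle t ht)

variable {θ0 α c K : ℝ}

lemma rpow_sub_rpow_ge {z δ t : ℝ} (hα : α ∈ Ioo (0 : ℝ) 1) (hK : 0 < K) (ht : 0 < t)
    (hδ : 0 ≤ δ) (hδz : δ ≤ z) (hz : t * z ^ α ≤ K) :
    α * (t / K) ^ (1 / α - 1) * δ ≤ z ^ α - (z - δ) ^ α := by
  obtain ⟨hα0, hα1⟩ := hα
  rcases (hδ.trans hδz).eq_or_lt with h0 | hzpos
  · have : δ = 0 := le_antisymm (h0 ▸ hδz) hδ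
    simp [this]
  · have h1 : (z - δ) ^ α ≤ z ^ α * (1 + α * (-(δ / z))) := by
      have hb := rpow_one_add_le_one_add_mul_self (s := -(δ / z))
        (neg_le_neg ((div_le_one hzpos).2 hδz)) hα0.le hα1.le
      have hd : 0 ≤ 1 + -(δ / z) := by
        have := (div_le_one hzpos).2 hδz
        linarith
      calc (z - δ) ^ α = (z * (1 + -(δ / z))) ^ α := by congr 1; field_simp; ring
        _ = z ^ α * (1 + -(δ / z)) ^ α := mul_rpow hzpos.le hd
        _ ≤ _ := by gcongr
    have hzα : 0 < z ^ α := rpow_pos_of_pos hzpos _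
    have h2 : (t / K) ^ (1 / α - 1) ≤ z ^ (α - 1) := by
      have h3 : t / K ≤ z ^ (-α) := by
        rw [rpow_neg hzpos.le, div_le_iff₀ hK, ← div_eq_inv_mul, le_div_iff₀ hzα]
        exact hz
      have h4 : 0 ≤ 1 / α - 1 := by
        rw [sub_nonneg, le_div_iff₀ hα0]
        linarith
      calc (t / K) ^ (1 / α - 1) ≤ (z ^ (-α)) ^ (1 / α - 1) :=
            rpow_le_rpow (by positivity) h3 h4
        _ = z ^ (α - 1) := by
            rw [← rpow_mul hzpos.le]
            congr 1
            field_simp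
            ring
    have h5 : z ^ (α - 1) = z ^ α / z := by rw [rpow_sub hzpos, rpow_one]
    have h6 : α * (t / K) ^ (1 / α - 1) * δ ≤ α * (z ^ α / z) * δ := by
      rw [← h5]
      gcongr
    have h7 : z ^ α * (1 + α * (-(δ / z))) = z ^ α - α * (z ^ α / z) * δ := by
      field_simp
      ring
    linarith

lemma integral_mul_div_rpow {s : ℝ} (hα : α ∈ Ioo (0 : ℝ) 1) (hK : 0 < K) (hs : 0 < s) :
    IntegrableOn (fun t => c * (α * (t / K) ^ (1 / α - 1))) (Ioo 0 s) ∧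
    ∫ t in Ioo 0 s, c * (α * (t / K) ^ (1 / α - 1))
      = c * α ^ 2 * (1 / K) ^ (1 / α - 1) * s ^ (1 / α) := by
  have hα0 := hα.1
  have hp : 0 < 1 / α - 1 := by
    rw [sub_pos, lt_div_iff₀ hα0]
    linarith [hα.2]
  have he : EqOn (fun t => c * (α * (t / K) ^ (1 / α - 1)))
      (fun t => c * α * (1 / K) ^ (1 / α - 1) * t ^ (1 / α - 1)) (Ioo 0 s) := fun t ht => by
    have : t / K = 1 / K * t := by ring
    simp only [this, mul_rpow (one_div_nonneg.2 hK.le) ht.1.le]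
    ring
  have hi : IntegrableOn (fun t : ℝ => t ^ (1 / α - 1)) (Ioo 0 s) :=
    ((intervalIntegrable_iff_integrableOn_Ioo_of_le hs.le).1
      (intervalIntegral.intervalIntegrable_rpow' (by linarith)))
  refine ⟨(integrableOn_congr_fun he measurableSet_Ioo).2 (hi.const_mul _), ?_⟩
  rw [setIntegral_congr_fun measurableSet_Ioo he, integral_const_mul,
    ← integral_Ioc_eq_integral_Ioo, ← intervalIntegral.integral_of_le hs.le,
    integral_rpow (Or.inl (by linarith)), sub_add_cancel, zero_rpow (one_div_pos.2 hα0).ne',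
    sub_zero]
  field_simp

variable {J : ℝ → ℝ}

/-- Capping the control at a level `h` that is large enough near `0` does not decrease the
payoff. -/
lemma payoff_le_payoff_min (hθ0 : θ0 ∈ Ioo 0 (π / 2)) (hα : α ∈ Ioo (0 : ℝ) 1) (hc : 0 < c)
    (hJ : Monotone J) (hJr : ∀ y, J y ∈ Icc (0 : ℝ) 1) {θ u : ℝ → ℝ} (hA : Adm2 θ0 θ u)
    (hz : IntegrableOn (fun t => tail u t ^ α) (Ioi 0)) (hK : 0 < K)
    (hzK : ∫ t in Ioi 0, tail u t ^ α ≤ K) {h : ℝ → ℝ} (hm : Measurable h) (h0 : ∀ t, 0 ≤ h t)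
    (hh : ∀ t > 0, exp (-h t) ≤ c * α ^ 2 * (1 / K) ^ (1 / α - 1) * t ^ (1 / α)) :
    Adm2 θ0 θ (fun t => min (u t) (h t)) ∧
    IntegrableOn (fun t => tail (fun t => min (u t) (h t)) t ^ α) (Ioi 0) ∧
    ∫ t in Ioi 0, tail (fun t => min (u t) (h t)) t ^ α ≤ K ∧
    Payoff θ0 α c J θ u ≤ Payoff θ0 α c J θ (fun t => min (u t) (h t)) := by
  set v : ℝ → ℝ := fun t => min (u t) (h t) with hv
  have hA' := hA
  obtain ⟨hθm, hum, hθ, hu, hui⟩ := hA'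
  have hvm : Measurable v := hum.min hm
  have hv0 : ∀ t, 0 ≤ v t := fun t => le_min (hu t) (h0 t)
  have hvi : IntegrableOn v (Ioi 0) := hui.mono' hvm.aestronglyMeasurable
    (ae_of_all _ fun t => by rw [norm_of_nonneg (hv0 t)]; exact min_le_left _ _)
  have hB : Adm2 θ0 θ v := ⟨hθm, hvm, hθ, hv0, hvi⟩
  set d : ℝ → ℝ := fun t => u t - v t with hd
  have hd0 : ∀ t, 0 ≤ d t := fun t => sub_nonneg.2 (min_le_left _ _)
  have hdi : IntegrableOn d (Ioi 0) := hui.sub hvi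
  have htail : ∀ t ≥ 0, tail v t = tail u t - tail d t := fun t ht => by
    have hs : Ioi t ⊆ Ioi 0 := Ioi_subset_Ioi ht
    have : tail d t = tail u t - tail v t :=
      integral_sub (hui.mono_set hs) (hvi.mono_set hs)
    linarith
  have hle : ∀ t ≥ 0, tail v t ^ α ≤ tail u t ^ α := fun t ht => by
    refine rpow_le_rpow (tail_nonneg hv0 t) ?_ hα.1.le
    rw [htail t ht]
    exact sub_le_self _ (tail_nonneg hd0 t)
  have hzv : IntegrableOn (fun t => tail v t ^ α) (Ioi 0) := by
    refine hz.mono' (aemeasurable_tail_rpow hα.1.le hv0 hvi).aestronglyMeasurable ?_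
    filter_upwards [ae_restrict_mem measurableSet_Ioi] with t ht
    rw [norm_of_nonneg (rpow_nonneg (tail_nonneg hv0 t) _)]
    exact hle t (le_of_lt ht)
  refine ⟨hB, hzv, (setIntegral_mono_on hzv hz measurableSet_Ioi fun t ht =>
    hle t (le_of_lt ht)).trans hzK, ?_⟩
  rw [payoff_eq_sub hθ0 hJ hJr hA hz, payoff_eq_sub hθ0 hJ hJr hB hzv]
  have hψd : IntegrableOn (fun s => exp (-h s) * d s) (Ioi 0) :=
    hdi.bdd_mul (c := 1) (by fun_prop) (ae_of_all _ fun t => by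
      rw [norm_eq_abs, abs_exp]
      exact exp_le_one_iff.2 (neg_nonpos.2 (h0 t)))
  have hgain : ∫ s in Ioi 0, exp (-h s) * d s
      ≤ ∫ t in Ioi 0, c * (tail u t ^ α - tail v t ^ α) := by
    refine integral_mul_le_integral_of_mul_tail_le
      (κ := fun t => c * (α * (t / K) ^ (1 / α - 1))) (by fun_prop) (fun t ht => ?_)
      (fun s hs => (integral_mul_div_rpow hα hK hs).1)
      (fun s hs => (hh s hs).trans (integral_mul_div_rpow hα hK hs).2.ge)
      (fun s => exp_nonneg _) (hum.sub hvm) hd0 hdi hψd ((hz.sub hzv).const_mul c)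
      (fun t ht => ?_)
    · have := hα.1
      positivity
    · rw [mul_assoc, htail t (le_of_lt ht)]
      refine mul_le_mul_of_nonneg_left (rpow_sub_rpow_ge hα hK ht (tail_nonneg hd0 t) ?_ ?_) hc.le
      · have h1 := tail_nonneg hv0 t
        rw [htail t (le_of_lt ht)] at h1
        linarith
      · exact (mul_tail_rpow_le hα.1.le hu hui hz (le_of_lt ht)).trans hzK
  have hloss : (∫ t in Ioi (0 : ℝ), J (height θ t) * G2 θ0 (θ t) (u t))
      - ∫ t in Ioi (0 : ℝ), J (height θ t) * G2 θ0 (θ t) (v t)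
      ≤ ∫ s in Ioi 0, exp (-h s) * d s := by
    have i1 := integrableOn_reward hθ0 hJ hJr hA
    have i2 := integrableOn_reward hθ0 hJ hJr hB
    rw [← integral_sub i1 i2]
    refine setIntegral_mono (i1.sub i2) hψd fun t => ?_
    have h1 := G2_sub_min_le (u := u t) (cos_sub_pos_of_mem hθ0 (hθ t)) (h0 t)
    rw [← mul_sub]
    calc J (height θ t) * (G2 θ0 (θ t) (u t) - G2 θ0 (θ t) (v t))
        ≤ J (height θ t) * (exp (-h t) * d t) := mul_le_mul_of_nonneg_left h1 (hJr _).1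
      _ ≤ exp (-h t) * d t :=
        mul_le_of_le_one_left (mul_nonneg (exp_nonneg _) (hd0 t)) (hJr _).2
  rw [integral_const_mul, integral_sub hz hzv] at hgain
  linarith

/-- A square-integrable (after exponential damping) cap dominating a given logarithm. -/
lemma exists_cap {B p : ℝ} (hB : 0 < B) (hp : 0 < p) :
    ∃ h : ℝ → ℝ, Measurable h ∧ (∀ t, 1 ≤ h t) ∧ (∀ t > 0, exp (-h t) ≤ B * t ^ p) ∧
      MemLp (fun t => h t * exp (-t)) 2 (volume.restrict (Ioi 0)) := by
  set A := 1 + |log B| + 4 * p with hA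
  have hA1 : 1 ≤ A := by
    have := abs_nonneg (log B)
    linarith
  have hr : ∀ t : ℝ, 0 ≤ |t| ^ (-(1 / 4) : ℝ) := fun t => rpow_nonneg (abs_nonneg t) _
  refine ⟨fun t => A * (1 + |t| ^ (-(1 / 4) : ℝ)), by fun_prop, fun t => ?_, fun t ht => ?_, ?_⟩
  · nlinarith [hr t]
  · beta_reduce
    rw [← log_le_log_iff (exp_pos _) (by positivity), log_exp, log_mul hB.ne'
      (rpow_pos_of_pos ht _).ne', log_rpow ht, abs_of_pos ht]
    have h1 := log_le_rpow_div (inv_nonneg.2 ht.le) (ε := 1 / 4) (by norm_num)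
    rw [log_inv, inv_rpow ht.le, ← rpow_neg ht.le] at h1
    have h2 := neg_abs_le (log B)
    have h3 : 0 ≤ t ^ (-(1 / 4) : ℝ) := rpow_nonneg ht.le _
    have h4 : p * -log t ≤ p * (t ^ (-(1 / 4) : ℝ) / (1 / 4)) := by gcongr
    have h5 : 0 ≤ |log B| * t ^ (-(1 / 4) : ℝ) := mul_nonneg (abs_nonneg _) h3
    nlinarith
  · have hmeas : Measurable fun t : ℝ => A * (1 + |t| ^ (-(1 / 4) : ℝ)) * exp (-t) := by
      fun_prop
    rw [memLp_two_iff_integrable_sq hmeas.aestronglyMeasurable]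
    have h1 := GammaIntegral_convergent (s := 1) one_pos
    have h2 := GammaIntegral_convergent (s := 1 / 2) (by norm_num)
    refine ((h1.add h2).const_mul (2 * A ^ 2)).mono' (hmeas.pow_const 2).aestronglyMeasurable ?_
    filter_upwards [ae_restrict_mem measurableSet_Ioi] with t ht
    have ht' : 0 < t := ht
    have e1 : t ^ ((1 / 2 : ℝ) - 1) = (t ^ (-(1 / 4) : ℝ)) ^ 2 := by
      rw [← rpow_natCast, ← rpow_mul ht'.le]
      norm_num
    have hexp : exp (-t) ≤ 1 := exp_le_one_iff.2 (by linarith)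
    rw [norm_of_nonneg (by positivity)]
    simp only [Pi.add_apply, sub_self, rpow_zero, e1, abs_of_pos ht']
    set r := t ^ (-(1 / 4) : ℝ)
    have h3 : (1 + r) ^ 2 ≤ 2 * (1 + r ^ 2) := by nlinarith [sq_nonneg (1 - r)]
    have h4 : exp (-t) ^ 2 ≤ exp (-t) := by nlinarith [exp_pos (-t)]
    calc (A * (1 + r) * exp (-t)) ^ 2 = A ^ 2 * ((1 + r) ^ 2 * exp (-t) ^ 2) := by ring
      _ ≤ A ^ 2 * (2 * (1 + r ^ 2) * exp (-t)) := by gcongr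
      _ = _ := by ring

end Truncation

section Limit

open Real MeasureTheory Set Filter Topology

lemma WeakTo.congr_lim {F : ℕ → ℝ → ℝ} {f g : ℝ → ℝ} (h : WeakTo F f)
    (hfg : f =ᵐ[volume.restrict (Ioi 0)] g) : WeakTo F g := by
  have hR : ∀ R, f =ᵐ[volume.restrict (Ioc 0 R)] g := fun R =>
    ae_restrict_of_ae_restrict_of_subset Ioc_subset_Ioi_self hfg
  refine ⟨fun R => Integrable.congr (h.integrableOn_lim R) (hR R), h.integrableOn,
    fun R k hk hb => ?_⟩
  have : ∫ t in Ioc 0 R, k t * g t = ∫ t in Ioc 0 R, k t * f t :=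
    integral_congr_ae ((hR R).mono fun t ht => by simp only [ht])
  rw [this]
  exact h.tendsto R k hk hb

lemma integrable_and_integral_le_of_tendsto {X : Type*} [MeasurableSpace X] {μ : Measure X}
    {f : ℕ → X → ℝ} {g : X → ℝ} {M : ℝ} (hf : ∀ n, Integrable (f n) μ)
    (hf0 : ∀ n x, 0 ≤ f n x) (hg : AEMeasurable g μ) (hg0 : ∀ x, 0 ≤ g x)
    (hlim : ∀ᵐ x ∂μ, Tendsto (fun n => f n x) atTop (𝓝 (g x)))
    (hM : ∀ᶠ n in atTop, ∫ x, f n x ∂μ ≤ M) : Integrable g μ ∧ ∫ x, g x ∂μ ≤ M := by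
  have hM0 : 0 ≤ M := by
    obtain ⟨n, hn⟩ := hM.exists
    exact (integral_nonneg (hf0 n)).trans hn
  have key : ∫⁻ x, ENNReal.ofReal (g x) ∂μ ≤ ENNReal.ofReal M := by
    calc ∫⁻ x, ENNReal.ofReal (g x) ∂μ
        = ∫⁻ x, liminf (fun n => ENNReal.ofReal (f n x)) atTop ∂μ := by
          refine lintegral_congr_ae (hlim.mono fun x hx => ?_)
          exact ((ENNReal.continuous_ofReal.tendsto _).comp hx).liminf_eq.symm
      _ ≤ liminf (fun n => ∫⁻ x, ENNReal.ofReal (f n x) ∂μ) atTop :=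
          lintegral_liminf_le' fun n => (hf n).aemeasurable.ennreal_ofReal
      _ ≤ ENNReal.ofReal M := by
          refine liminf_le_of_frequently_le' (hM.mono fun n hn => ?_).frequently
          rw [← ofReal_integral_eq_lintegral_ofReal (hf n) (ae_of_all _ (hf0 n))]
          exact ENNReal.ofReal_le_ofReal hn
  have hgi : Integrable g μ := by
    refine ⟨hg.aestronglyMeasurable, ?_⟩
    rw [hasFiniteIntegral_iff_ofReal (ae_of_all _ hg0)]
    exact key.trans_lt ENNReal.ofReal_lt_top
  refine ⟨hgi, ?_⟩
  rw [← ENNReal.ofReal_le_ofReal_iff hM0,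
    ofReal_integral_eq_lintegral_ofReal hgi (ae_of_all _ hg0)]
  exact key

variable {θ0 α c K S : ℝ} {J : ℝ → ℝ} {θ u : ℕ → ℝ → ℝ}

/-- Weak limits of `(sin θ, cos θ)` lie in the convex hull of the arc, hence are dominated by an
angle with the same sine. -/
lemma exists_angle_of_weakTo (hθ0 : θ0 ∈ Ioo 0 (π / 2)) (hθ : ∀ n t, θ n t ∈ Icc θ0 (π / 2))
    {p q : ℝ → ℝ} (hp : Measurable p) (hq : Measurable q)
    (hpw : WeakTo (fun n t => sin (θ n t)) p) (hqw : WeakTo (fun n t => cos (θ n t)) q) :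
    ∃ φ : ℝ → ℝ, Measurable φ ∧ (∀ t, φ t ∈ Icc θ0 (π / 2)) ∧
      (p =ᵐ[volume.restrict (Ioi 0)] fun t => sin (φ t)) ∧
      ∀ᵐ t ∂volume.restrict (Ioi 0), q t ≤ cos (φ t) := by
  have hconst : ∀ a : ℝ, ∃ C, ∀ _ : ℝ, |a| ≤ C := fun a => ⟨|a|, fun _ => le_rfl⟩
  have hneg : ∃ C, ∀ _ : ℝ, |(-1 : ℝ)| ≤ C := hconst (-1)
  have h1 := hpw.ae_le (r := fun _ => 1) measurable_const (hconst 1) fun n t => sin_le_one _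
  have h2 := (hpw.bdd_mul (g := fun _ => -1) measurable_const hneg).ae_le
    (r := fun _ => -sin θ0) measurable_const (hconst _) fun n t => by
      have := sin_le_sin_of_le_of_le_pi_div_two (by linarith [hθ0.1, pi_pos]) (hθ n t).2
        (hθ n t).1
      linarith
  have h3 := hqw.ae_le (r := fun _ => 1) measurable_const (hconst 1) fun n t => cos_le_one _
  have h4 := (hqw.bdd_mul (g := fun _ => -1) measurable_const hneg).ae_le
    (r := fun _ => 0) measurable_const (hconst _) fun n t => by
      have := cos_nonneg_of_mem_Icc
        ⟨by linarith [hθ0.1, pi_pos, (hθ n t).1], (hθ n t).2⟩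
      linarith
  set a : ℝ → ℝ := fun t => max 0 (min 1 (p t)) with ha
  set b : ℝ → ℝ := fun t => max 0 (min 1 (q t)) with hb
  have ham : Measurable a := measurable_const.max (measurable_const.min hp)
  have hbm : Measurable b := measurable_const.max (measurable_const.min hq)
  have hclamp : ∀ r : ℝ, 0 ≤ max 0 (min 1 r) ∧ max 0 (min 1 r) ≤ 1 := fun r =>
    ⟨le_max_left _ _, max_le zero_le_one (min_le_left _ _)⟩
  have hclamp' : ∀ r : ℝ, |max 0 (min 1 r)| ≤ 1 := fun r => by
    rw [abs_of_nonneg (hclamp r).1]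
    exact (hclamp r).2
  have h5 := ((hpw.bdd_mul ham ⟨1, fun t => hclamp' _⟩).add
    (hqw.bdd_mul hbm ⟨1, fun t => hclamp' _⟩)).ae_le
    (r := fun t => (a t ^ 2 + b t ^ 2 + 1) / 2) (by fun_prop) ⟨2, fun t => by
      have ha1 := hclamp (p t)
      have hb1 := hclamp (q t)
      rw [abs_of_nonneg (by positivity)]
      simp only [ha, hb]
      nlinarith⟩ fun n t => by
      nlinarith [sq_nonneg (a t - sin (θ n t)), sq_nonneg (b t - cos (θ n t)),
        sin_sq_add_cos_sq (θ n t)]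
  have hpi := pi_pos
  have hs0 : 0 < sin θ0 := sin_pos_of_pos_of_lt_pi hθ0.1 (by linarith [hθ0.2])
  have hgood : ∀ᵐ t ∂volume.restrict (Ioi 0),
      sin (max θ0 (arcsin (p t))) = p t ∧ q t ≤ cos (max θ0 (arcsin (p t))) := by
    filter_upwards [h1, h2, h3, h4, h5] with t h1 h2 h3 h4 h5
    have hp0 : sin θ0 ≤ p t := by linarith
    have hq0 : 0 ≤ q t := by linarith
    have ea : a t = p t := by simp [ha, h1, hs0.le.trans hp0]
    have eb : b t = q t := by simp [hb, h3, hq0]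
    rw [ea, eb] at h5
    have hmax : max θ0 (arcsin (p t)) = arcsin (p t) := by
      refine max_eq_right ((le_arcsin_iff_sin_le' ⟨by linarith [hθ0.1], hθ0.2.le⟩).2 hp0)
    rw [hmax]
    refine ⟨sin_arcsin (by linarith) h1, ?_⟩
    rw [cos_arcsin]
    exact le_sqrt_of_sq_le (by nlinarith)
  refine ⟨fun t => max θ0 (arcsin (p t)), measurable_const.max (measurable_arcsin.comp hp),
    fun t => ⟨le_max_left _ _, max_le hθ0.2.le (arcsin_le_pi_div_two _)⟩,
    hgood.mono fun t ht => ht.1.symm, hgood.mono fun t ht => ht.2⟩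

lemma tendsto_tail_atTop {v : ℝ → ℝ} (hvi : IntegrableOn v (Ioi 0)) :
    Tendsto (tail v) atTop (𝓝 0) := by
  have h := intervalIntegral_tendsto_integral_Ioi 0 hvi tendsto_id
  have h2 : Tendsto (fun R => (∫ t in Ioi 0, v t) - ∫ t in (0 : ℝ)..R, v t) atTop (𝓝 0) := by
    simpa using (tendsto_const_nhds (x := ∫ t in Ioi 0, v t)).sub h
  refine h2.congr' ?_
  filter_upwards [eventually_ge_atTop 0] with R hR
  have := tail_eq_add hvi le_rfl hR
  rw [intervalIntegral.integral_of_le hR]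
  unfold tail at *
  linarith

lemma integrableOn_Ioi_of_weakTo {v : ℝ → ℝ} {M : ℝ} (hu : ∀ n t, 0 ≤ u n t)
    (hui : ∀ n, IntegrableOn (u n) (Ioi 0)) (hv0 : ∀ t, 0 ≤ v t) (huv : WeakTo u v)
    (hM : ∀ n, tail (u n) 1 ≤ M) : IntegrableOn v (Ioi 0) := by
  refine integrableOn_Ioi_of_intervalIntegral_norm_bounded (l := atTop) (b := id)
    ((∫ t in Ioc 0 1, v t) + M) 0 huv.integrableOn_lim tendsto_id ?_
  filter_upwards [eventually_ge_atTop 1] with R hR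
  have hR0 : (0 : ℝ) ≤ R := zero_le_one.trans hR
  simp only [id, norm_of_nonneg (hv0 _)]
  rw [intervalIntegral.integral_of_le hR0]
  refine le_of_tendsto_of_tendsto' (huv.tendsto_setIntegral R measurableSet_Ioc le_rfl)
    ((huv.tendsto_setIntegral 1 measurableSet_Ioc le_rfl).add_const M) fun n => ?_
  have h1 := tail_eq_add (hui n) le_rfl hR0
  have h2 := tail_eq_add (hui n) le_rfl zero_le_one
  linarith [tail_nonneg (hu n) R, hM n]

lemma tendsto_tail_of_weakTo {v η : ℝ → ℝ} (hu : ∀ n t, 0 ≤ u n t)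
    (hui : ∀ n, IntegrableOn (u n) (Ioi 0)) (hv0 : ∀ t, 0 ≤ v t)
    (hvi : IntegrableOn v (Ioi 0)) (huv : WeakTo u v) (hη : Tendsto η atTop (𝓝 0))
    (hle : ∀ n, ∀ R > 0, tail (u n) R ≤ η R) {t : ℝ} (ht : 0 ≤ t) :
    Tendsto (fun n => tail (u n) t) atTop (𝓝 (tail v t)) := by
  rw [Metric.tendsto_atTop']
  intro ε hε
  obtain ⟨R, hR1, hR2, hR3, hR4⟩ := ((hη.eventually_lt_const (show 0 < ε / 3 by positivity)).and
    (((tendsto_tail_atTop hvi).eventually_lt_const (show 0 < ε / 3 by positivity)).and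
      ((eventually_ge_atTop t).and (eventually_gt_atTop 0)))).exists
  obtain ⟨N, hN⟩ := Metric.tendsto_atTop'.1 (huv.tendsto_setIntegral R
    (measurableSet_Ioc (a := t) (b := R)) (Ioc_subset_Ioc_left ht)) (ε / 3) (by positivity)
  refine ⟨N, fun n hn => ?_⟩
  have h1 := hN n hn
  rw [Real.dist_eq, abs_lt] at h1 ⊢
  rw [tail_eq_add (hui n) ht hR3, tail_eq_add hvi ht hR3]
  have h2 := hle n R hR4
  have h3 := tail_nonneg (hu n) R
  have h4 := tail_nonneg hv0 R
  constructor <;> linarith [h1.1, h1.2]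

lemma tendsto_height_of_weakTo {φ : ℝ → ℝ}
    (hw : WeakTo (fun n t => sin (θ n t)) fun t => sin (φ t)) {t : ℝ} (ht : 0 ≤ t) :
    Tendsto (fun n => height (θ n) t) atTop (𝓝 (height φ t)) := by
  simp only [height, intervalIntegral.integral_of_le ht]
  exact hw.tendsto_setIntegral t measurableSet_Ioc le_rfl

lemma strictMono_height (hθ0 : θ0 ∈ Ioo 0 (π / 2)) {φ : ℝ → ℝ} (hφ : Measurable φ)
    (hφr : ∀ t, φ t ∈ Icc θ0 (π / 2)) : StrictMono (height φ) := by
  intro s t hst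
  have hpi := pi_pos
  have h := intervalIntegral.integral_add_adjacent_intervals
    (intervalIntegrable_sin hφ 0 s) (intervalIntegrable_sin hφ s t)
  have hpos : 0 < ∫ r in s..t, sin (φ r) :=
    intervalIntegral.intervalIntegral_pos_of_pos (intervalIntegrable_sin hφ s t)
      (fun r => sin_pos_of_pos_of_lt_pi (hθ0.1.trans_le (hφr r).1)
        (by linarith [(hφr r).2])) hst
  unfold height
  linarith

lemma ae_tendsto_comp_height (hθ0 : θ0 ∈ Ioo 0 (π / 2)) (hJ : Monotone J) {φ : ℝ → ℝ}
    (hφ : Measurable φ) (hφr : ∀ t, φ t ∈ Icc θ0 (π / 2))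
    (hw : WeakTo (fun n t => sin (θ n t)) fun t => sin (φ t)) :
    ∀ᵐ t ∂volume.restrict (Ioi 0),
      Tendsto (fun n => J (height (θ n) t)) atTop (𝓝 (J (height φ t))) := by
  have hcount : {t | ¬ContinuousAt J (height φ t)}.Countable :=
    hJ.countable_not_continuousAt.preimage_of_injOn
      (strictMono_height hθ0 hφ hφr).injective.injOn
  have hae : ∀ᵐ t ∂volume.restrict (Ioi (0 : ℝ)), t ∉ {t | ¬ContinuousAt J (height φ t)} :=
    hcount.ae_notMem _
  filter_upwards [hae, ae_restrict_mem measurableSet_Ioi] with t ht ht0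
  exact (not_not.1 ht).tendsto.comp (tendsto_height_of_weakTo hw (le_of_lt ht0))

/-- Upper semicontinuity of the reward on a bounded time interval. -/
lemma eventually_setIntegral_reward_le (hθ0 : θ0 ∈ Ioo 0 (π / 2)) (hJ : Monotone J)
    (hJr : ∀ y, J y ∈ Icc (0 : ℝ) 1) (hA : ∀ n, Adm2 θ0 (θ n) (u n)) {φ v q : ℝ → ℝ}
    (hB : Adm2 θ0 φ v) (hw : WeakTo (fun n t => sin (θ n t)) fun t => sin (φ t))
    (hq : WeakTo (fun n t => cos (θ n t)) q)
    (hqle : ∀ᵐ t ∂volume.restrict (Ioi 0), q t ≤ cos (φ t)) (huv : WeakTo u v) (R : ℝ)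
    {ε : ℝ} (hε : 0 < ε) :
    ∀ᶠ n in atTop, ∫ t in Ioc 0 R, J (height (θ n) t) * G2 θ0 (θ n t) (u n t)
      ≤ (∫ t in Ioc 0 R, J (height φ t) * G2 θ0 (φ t) (v t)) + ε := by
  have hpi := pi_pos
  have hcos : ∀ t, 0 < cos (φ t - θ0) := fun t => cos_sub_pos_of_mem hθ0 (hB.2.2.1 t)
  have hmh : ∀ {ψ : ℝ → ℝ}, Measurable ψ → Measurable fun t => J (height ψ t) := fun h =>
    hJ.measurable.comp (continuous_height h).measurable
  set x : ℝ → ℝ := fun t => v t / cos (φ t - θ0) with hx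
  have hφm := hB.1
  have hvm := hB.2.1
  have hxm : Measurable x := by fun_prop
  have hx0 : ∀ t, 0 ≤ x t := fun t => div_nonneg (hB.2.2.2.1 t) (hcos t).le
  set A : ℝ → ℝ := fun t => J (height φ t) * (1 - exp (-x t) - x t * exp (-x t)) with hAdef
  set B : ℝ → ℝ := fun t => J (height φ t) * exp (-x t) with hBdef
  have hJm := hmh hφm
  have hAm : Measurable A :=
    hJm.mul ((measurable_const.sub hxm.neg.exp).sub (hxm.mul hxm.neg.exp))
  have hBm : Measurable B := hJm.mul hxm.neg.exp
  have hA0 : ∀ t, 0 ≤ A t := fun t => mul_nonneg (hJr _).1 (one_sub_exp_sub_nonneg _)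
  have hA1 : ∀ t, A t ≤ 1 := fun t => mul_le_one₀ (hJr _).2 (one_sub_exp_sub_nonneg _) (by
    have := mul_nonneg (hx0 t) (exp_nonneg (-x t))
    have := exp_nonneg (-x t)
    linarith)
  have hB1 : ∀ t, |B t| ≤ 1 := fun t => by
    rw [abs_of_nonneg (mul_nonneg (hJr _).1 (exp_nonneg _))]
    exact mul_le_one₀ (hJr _).2 (exp_nonneg _) (exp_le_one_iff.2 (neg_nonpos.2 (hx0 t)))
  have hAk : ∀ k : ℝ, ∃ C, ∀ t, |A t * k| ≤ C := fun k => ⟨1 * |k|, fun t => by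
    rw [abs_mul, abs_of_nonneg (hA0 t)]
    exact mul_le_mul_of_nonneg_right (hA1 t) (abs_nonneg k)⟩
  have hW := ((hq.bdd_mul (hAm.mul_const (cos θ0)) (hAk _)).add
    (hw.bdd_mul (hAm.mul_const (sin θ0)) (hAk _))).add (huv.bdd_mul hBm ⟨1, hB1⟩)
  have hlim := hW.tendsto_setIntegral R measurableSet_Ioc le_rfl
  have hsub : Ioc 0 R ⊆ Ioi (0 : ℝ) := Ioc_subset_Ioi_self
  have hfin : IsFiniteMeasure (volume.restrict (Ioc 0 R)) := ⟨by simp⟩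
  have hdiff : Tendsto (fun n => ∫ t in Ioc 0 R, |J (height (θ n) t) - J (height φ t)|) atTop
      (𝓝 0) := by
    have hae := ae_restrict_of_ae_restrict_of_subset hsub
      (ae_tendsto_comp_height hθ0 hJ hφm hB.2.2.1 hw)
    have := tendsto_integral_of_dominated_convergence (μ := volume.restrict (Ioc 0 R))
      (F := fun n t => |J (height (θ n) t) - J (height φ t)|) (f := fun _ => 0) (fun _ => 1)
      (fun n => ((hmh (hA n).1).sub hJm).norm.aestronglyMeasurable) (integrable_const _)
      (fun n => ae_of_all _ fun t => by
        rw [norm_eq_abs, abs_abs, abs_le]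
        constructor <;>
          linarith [(hJr (height (θ n) t)).1, (hJr (height (θ n) t)).2,
            (hJr (height φ t)).1, (hJr (height φ t)).2])
      (hae.mono fun t ht => by simpa using (ht.sub_const (J (height φ t))).abs)
    simpa using this
  have hlimle : ∫ t in Ioc 0 R, (A t * cos θ0 * q t + A t * sin θ0 * sin (φ t) + B t * v t)
      ≤ ∫ t in Ioc 0 R, J (height φ t) * G2 θ0 (φ t) (v t) := by
    refine integral_mono_ae (hW.integrableOn_lim R)
      ((integrableOn_reward hθ0 hJ hJr hB).mono_set hsub) ?_
    filter_upwards [ae_restrict_of_ae_restrict_of_subset hsub hqle] with t ht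
    have hc0 : 0 ≤ cos θ0 := cos_nonneg_of_mem_Icc ⟨by linarith [hθ0.1], hθ0.2.le⟩
    have h1 : A t * cos θ0 * q t ≤ A t * cos θ0 * cos (φ t) :=
      mul_le_mul_of_nonneg_left ht (mul_nonneg (hA0 t) hc0)
    have h2 : J (height φ t) * G2 θ0 (φ t) (v t) = A t * cos (φ t - θ0) + B t * v t := by
      rw [G2_eq_affine (hcos t)]
      simp only [hAdef, hBdef, hx]
      ring
    rw [h2, cos_sub]
    linarith
  have hsum := hdiff.add hlim
  rw [zero_add] at hsum
  have hev := hsum.eventually_lt_const (lt_add_of_le_of_pos hlimle hε)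
  refine hev.mono fun n hn => le_trans ?_ hn.le
  have hdi : Integrable (fun t => |J (height (θ n) t) - J (height φ t)|)
      (volume.restrict (Ioc 0 R)) :=
    Integrable.of_bound ((hmh (hA n).1).sub hJm).norm.aestronglyMeasurable 1
      (ae_of_all _ fun t => by
        rw [norm_eq_abs, abs_abs, abs_le]
        constructor <;>
          linarith [(hJr (height (θ n) t)).1, (hJr (height (θ n) t)).2,
            (hJr (height φ t)).1, (hJr (height φ t)).2])
  rw [← integral_add hdi (hW.integrableOn n R)]
  refine integral_mono ((integrableOn_reward hθ0 hJ hJr (hA n)).mono_set hsub)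
    (hdi.add (hW.integrableOn n R)) fun t => ?_
  have hcn := cos_sub_pos_of_mem hθ0 ((hA n).2.2.1 t)
  have hG0 := G2_nonneg hcn ((hA n).2.2.2.1 t)
  have hG1 := G2_le_one (u := u n t) hcn
  have h1 : (J (height (θ n) t) - J (height φ t)) * G2 θ0 (θ n t) (u n t)
      ≤ |J (height (θ n) t) - J (height φ t)| :=
    (mul_le_mul_of_nonneg_right (le_abs_self _) hG0).trans
      (mul_le_of_le_one_right (abs_nonneg _) hG1)
  have h2 := mul_le_mul_of_nonneg_left (G2_le_affine hcn (u n t) (x t)) (hJr (height φ t)).1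
  rw [cos_sub] at h2
  simp only [hAdef, hBdef]
  nlinarith

lemma tail_le_of_integral_rpow_le (hα : 0 < α) {v : ℝ → ℝ} (hv : ∀ t, 0 ≤ v t)
    (hvi : IntegrableOn v (Ioi 0)) (hz : IntegrableOn (fun t => tail v t ^ α) (Ioi 0))
    (hK : ∫ t in Ioi 0, tail v t ^ α ≤ K) {R : ℝ} (hR : 0 < R) :
    tail v R ≤ (K / R) ^ (1 / α) := by
  have h1 := (mul_tail_rpow_le hα.le hv hvi hz hR.le).trans hK
  calc tail v R = (tail v R ^ α) ^ (1 / α) := by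
        rw [← rpow_mul (tail_nonneg hv R), mul_one_div_cancel hα.ne', rpow_one]
    _ ≤ _ := rpow_le_rpow (rpow_nonneg (tail_nonneg hv R) _)
      (by rw [le_div_iff₀ hR]; linarith) (by positivity)

/-- The limit of payoffs of uniformly capped controls is attained or exceeded. -/
lemma exists_adm_payoff_ge (hθ0 : θ0 ∈ Ioo 0 (π / 2)) (hα : α ∈ Ioo (0 : ℝ) 1) (hc : 0 < c)
    (hJ : Monotone J) (hJr : ∀ y, J y ∈ Icc (0 : ℝ) 1) (hA : ∀ n, Adm2 θ0 (θ n) (u n))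
    (hz : ∀ n, IntegrableOn (fun t => tail (u n) t ^ α) (Ioi 0))
    (hzK : ∀ n, ∫ t in Ioi 0, tail (u n) t ^ α ≤ K) {h : ℝ → ℝ} (h1 : ∀ t, 1 ≤ h t)
    (h2 : MemLp (fun t => h t * exp (-t)) 2 (volume.restrict (Ioi 0)))
    (huh : ∀ n t, u n t ≤ h t)
    (hS : Tendsto (fun n => Payoff θ0 α c J (θ n) (u n)) atTop (𝓝 S)) :
    ∃ φ v, Adm2 θ0 φ v ∧ S ≤ Payoff θ0 α c J φ v := by
  obtain ⟨p, m1, hpm, hm1, hp⟩ := exists_weakTo_subseq h2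
    (F := fun n t => sin (θ n t)) (fun n => measurable_sin.comp (hA n).1)
    (fun n t _ => (abs_sin_le_one _).trans (h1 t))
  obtain ⟨q, m2, hqm, hm2, hq⟩ := exists_weakTo_subseq h2
    (F := fun n t => cos (θ (m1 n) t)) (fun n => measurable_cos.comp (hA _).1)
    (fun n t _ => (abs_cos_le_one _).trans (h1 t))
  obtain ⟨r, m3, hrm, hm3, hr⟩ := exists_weakTo_subseq h2
    (F := fun n => u (m1 (m2 n))) (fun n => (hA _).2.1)
    (fun n t _ => by rw [abs_of_nonneg ((hA _).2.2.2.1 t)]; exact huh _ t)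
  replace hp := hp.comp (hm2.comp hm3)
  replace hq := hq.comp hm3
  set m : ℕ → ℕ := fun n => m1 (m2 (m3 n)) with hm
  have hS' : Tendsto (fun n => Payoff θ0 α c J (θ (m n)) (u (m n))) atTop (𝓝 S) :=
    hS.comp (hm1.comp (hm2.comp hm3)).tendsto_atTop
  obtain ⟨φ, hφm, hφr, hpφ, hqφ⟩ := exists_angle_of_weakTo (θ := fun n => θ (m n)) hθ0
    (fun n => (hA (m n)).2.2.1) hpm hqm hp hq
  have hw : WeakTo (fun n t => sin (θ (m n) t)) fun t => sin (φ t) := hp.congr_lim hpφ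
  set v : ℝ → ℝ := fun t => max 0 (r t) with hv
  have hrv : r =ᵐ[volume.restrict (Ioi 0)] v := by
    have := (hr.bdd_mul (g := fun _ => -1) measurable_const ⟨1, fun _ => by simp⟩).ae_le
      (r := fun _ => 0) measurable_const ⟨0, fun _ => by simp⟩ fun n t => by
        have := (hA (m n)).2.2.2.1 t
        simp only [hm] at this
        linarith
    filter_upwards [this] with t ht
    exact (max_eq_right (by linarith)).symm
  have huv : WeakTo (fun n => u (m n)) v := hr.congr_lim hrv
  have hvm : Measurable v := measurable_const.max hrm
  have hv0 : ∀ t, 0 ≤ v t := fun t => le_max_left _ _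
  have hu0 : ∀ n t, 0 ≤ u (m n) t := fun n => (hA (m n)).2.2.2.1
  have hui : ∀ n, IntegrableOn (u (m n)) (Ioi 0) := fun n => (hA (m n)).2.2.2.2
  set η : ℝ → ℝ := fun R => (K / R) ^ (1 / α) with hη
  have hηle : ∀ n, ∀ R > 0, tail (u (m n)) R ≤ η R := fun n R hR =>
    tail_le_of_integral_rpow_le hα.1 (hu0 n) (hui n) (hz _) (hzK _) hR
  have hη0 : Tendsto η atTop (𝓝 0) := by
    have h3 : Tendsto (fun R : ℝ => K / R) atTop (𝓝 0) := tendsto_const_nhds.div_atTop tendsto_id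
    have h4 := h3.rpow_const (p := 1 / α) (Or.inr (one_div_pos.2 hα.1).le)
    rwa [zero_rpow (one_div_pos.2 hα.1).ne'] at h4
  have hvi : IntegrableOn v (Ioi 0) :=
    integrableOn_Ioi_of_weakTo hu0 hui hv0 huv fun n => hηle n 1 one_pos
  have hB : Adm2 θ0 φ v := ⟨hφm, hvm, hφr, hv0, hvi⟩
  set B := ∫ t in Ioi (0 : ℝ), J (height φ t) * G2 θ0 (φ t) (v t) with hBdef
  have hcost : ∀ ε > 0, IntegrableOn (fun t => tail v t ^ α) (Ioi 0) ∧
      ∫ t in Ioi 0, tail v t ^ α ≤ (B - S + 3 * ε) / c := by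
    intro ε hε
    refine integrable_and_integral_le_of_tendsto (f := fun n t => tail (u (m n)) t ^ α)
      (fun n => hz _) (fun n t => rpow_nonneg (tail_nonneg (hu0 n) t) _)
      (aemeasurable_tail_rpow hα.1.le hv0 hvi) (fun t => rpow_nonneg (tail_nonneg hv0 t) _) ?_ ?_
    · filter_upwards [ae_restrict_mem measurableSet_Ioi] with t ht
      exact (tendsto_tail_of_weakTo hu0 hui hv0 hvi huv hη0 hηle (le_of_lt ht)).rpow_const
        (Or.inr hα.1.le)
    · obtain ⟨R, hR, hR0⟩ := ((hη0.eventually_lt_const hε).and (eventually_gt_atTop 0)).exists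
      filter_upwards [eventually_setIntegral_reward_le hθ0 hJ hJr (fun n => hA (m n)) hB hw hq
        hqφ huv R hε, hS'.eventually_const_lt (sub_lt_self S hε)] with n hn1 hn2
      have hn3 := integral_reward_le hθ0 hJ hJr (hA (m n)) hR0.le
      have hn4 := hηle n R hR0
      have hn5 : ∫ t in Ioc 0 R, J (height φ t) * G2 θ0 (φ t) (v t) ≤ B :=
        setIntegral_mono_set (integrableOn_reward hθ0 hJ hJr hB)
          (ae_of_all _ (reward_nonneg hθ0 hJr hB)) Ioc_subset_Ioi_self.eventuallyLE
      rw [payoff_eq_sub hθ0 hJ hJr (hA (m n)) (hz _)] at hn2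
      rw [le_div_iff₀ hc]
      linarith
  refine ⟨φ, v, hB, ?_⟩
  rw [payoff_eq_sub hθ0 hJ hJr hB (hcost 1 one_pos).1, ← hBdef]
  refine le_of_forall_pos_le_add fun ε hε => ?_
  have := (hcost (ε / 3) (by positivity)).2
  rw [le_div_iff₀ hc] at this
  linarith

end Limit

section Existence

open Real MeasureTheory Set Filter Topology

variable {θ0 α c : ℝ} {J : ℝ → ℝ}

lemma payoff_zero (hα : α ≠ 0) (I : ℝ → ℝ) (θ : ℝ → ℝ) :
    Payoff θ0 α c I θ (fun _ => 0) = 0 := by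
  simp [Payoff, G2, zero_rpow hα]

lemma exists_optimal_of_monotone (hθ0 : θ0 ∈ Ioo 0 (π / 2)) (hα : α ∈ Ioo (0 : ℝ) 1)
    (hc : 0 < c) (hJ : Monotone J) (hJr : ∀ y, J y ∈ Icc (0 : ℝ) 1) :
    ∃ φ v, Adm2 θ0 φ v ∧ ∀ θ u, Adm2 θ0 θ u → Payoff θ0 α c J θ u ≤ Payoff θ0 α c J φ v := by
  by_cases hpos : ∃ θ u, Adm2 θ0 θ u ∧ 0 < Payoff θ0 α c J θ u
  swap
  · push Not at hpos
    refine ⟨fun _ => θ0, fun _ => 0, ⟨measurable_const, measurable_const,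
      fun _ => ⟨le_rfl, hθ0.2.le⟩, fun _ => le_rfl, integrableOn_zero⟩, fun θ u hA => ?_⟩
    rw [payoff_zero hα.1.ne']
    exact hpos θ u hA
  have hα0 := hα.1
  set M : ℝ := (2 / c) ^ (1 / α) with hM
  have hM0 : 0 < M := by positivity
  set K : ℝ := 2 / c * M with hK
  have hK0 : 0 < K := by positivity
  have hbound : ∀ θ u, Adm2 θ0 θ u → 0 < Payoff θ0 α c J θ u →
      IntegrableOn (fun t => tail u t ^ α) (Ioi 0) ∧ ∫ t in Ioi 0, tail u t ^ α ≤ K ∧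
        Payoff θ0 α c J θ u ≤ M := by
    intro θ u hA hp
    have hz := integrableOn_tail_rpow_of_payoff_pos hθ0 hc hJ hJr hA hp
    have h1 := integral_reward_le_half_cost hθ0 hα0 hc hJ hJr hA hz
    have hZ : 0 ≤ ∫ t in Ioi 0, tail u t ^ α :=
      integral_nonneg fun t => rpow_nonneg (tail_nonneg hA.2.2.2.1 t) _
    rw [payoff_eq_sub hθ0 hJ hJr hA hz] at hp ⊢
    refine ⟨hz, ?_, ?_⟩
    · rw [hK, div_mul_eq_mul_div, le_div_iff₀ hc]
      linarith
    · have := mul_nonneg hc.le hZ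
      linarith
  set P : Set ℝ := {x | ∃ θ u, Adm2 θ0 θ u ∧ 0 < Payoff θ0 α c J θ u ∧ Payoff θ0 α c J θ u = x}
    with hP
  have hne : P.Nonempty := by
    obtain ⟨θ, u, hA, hp⟩ := hpos
    exact ⟨_, θ, u, hA, hp, rfl⟩
  have hbdd : BddAbove P := ⟨M, by
    rintro _ ⟨θ, u, hA, hp, rfl⟩
    exact (hbound θ u hA hp).2.2⟩
  obtain ⟨x, -, hx, hxP⟩ := exists_seq_tendsto_sSup hne hbdd
  obtain ⟨h, hm, h1, hexp, h2⟩ := exists_cap (B := c * α ^ 2 * (1 / K) ^ (1 / α - 1))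
    (p := 1 / α) (by positivity) (by positivity)
  choose θ u hA hp hxe using hxP
  have htr := fun n => payoff_le_payoff_min hθ0 hα hc hJ hJr (hA n) (hbound _ _ (hA n) (hp n)).1
    hK0 (hbound _ _ (hA n) (hp n)).2.1 hm (fun t => zero_le_one.trans (h1 t)) hexp
  have hle : ∀ φ v, Adm2 θ0 φ v → 0 < Payoff θ0 α c J φ v → Payoff θ0 α c J φ v ≤ sSup P :=
    fun φ v hB hq => le_csSup hbdd ⟨φ, v, hB, hq, rfl⟩
  have hS : Tendsto (fun n => Payoff θ0 α c J (θ n) (fun t => min (u n t) (h t))) atTop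
      (𝓝 (sSup P)) :=
    tendsto_of_tendsto_of_tendsto_of_le_of_le hx tendsto_const_nhds
      (fun n => (hxe n).ge.trans (htr n).2.2.2)
      (fun n => hle _ _ (htr n).1 ((hp n).trans_le (htr n).2.2.2))
  obtain ⟨φ, v, hB, hSle⟩ := exists_adm_payoff_ge hθ0 hα hc hJ hJr (fun n => (htr n).1)
    (fun n => (htr n).2.1) (fun n => (htr n).2.2.1) h1 h2 (fun n t => min_le_right _ _) hS
  refine ⟨φ, v, hB, fun θ' u' hA' => le_trans ?_ hSle⟩
  by_cases hq : 0 < Payoff θ0 α c J θ' u'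
  · exact hle _ _ hA' hq
  · exact (not_lt.1 hq).trans (((hp 0).trans_le (hle _ _ (hA 0) (hp 0))).le)

lemma payoff_comp_max {I : ℝ → ℝ} (hθ0 : θ0 ∈ Ioo 0 (π / 2)) {θ u : ℝ → ℝ}
    (hA : Adm2 θ0 θ u) :
    Payoff θ0 α c (fun y => I (max y 0)) θ u = Payoff θ0 α c I θ u := by
  refine setIntegral_congr_fun measurableSet_Ioi fun t ht => ?_
  have hpi := pi_pos
  have hy : 0 ≤ ∫ s in (0 : ℝ)..t, sin (θ s) :=
    intervalIntegral.integral_nonneg (le_of_lt ht) fun s _ =>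
      sin_nonneg_of_nonneg_of_le_pi (hθ0.1.le.trans (hA.2.2.1 s).1)
        (by linarith [(hA.2.2.1 s).2])
  simp only [max_eq_left hy]

end Existence

/-- Existence of an optimal solution to problem (OP2). -/
theorem op2_exists (θ0 α c : ℝ) (hθ0 : θ0 ∈ Set.Ioo 0 (π / 2))
    (hα : α ∈ Set.Ioo (0 : ℝ) 1) (hc : 0 < c)
    (I : ℝ → ℝ) (hImono : MonotoneOn I (Set.Ici 0))
    (hIrange : ∀ y ∈ Set.Ici (0 : ℝ), I y ∈ Set.Icc (0 : ℝ) 1) :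
    ∃ θs us : ℝ → ℝ, Adm2 θ0 θs us ∧
      ∀ θ u : ℝ → ℝ, Adm2 θ0 θ u →
        Payoff θ0 α c I θ u ≤ Payoff θ0 α c I θs us := by
  obtain ⟨φ, v, hB, hopt⟩ := exists_optimal_of_monotone (α := α) (c := c)
    (J := fun y => I (max y 0)) hθ0 hα hc
    (fun a b hab => hImono (le_max_right a 0) (le_max_right b 0) (max_le_max_right 0 hab))
    (fun y => hIrange _ (le_max_right y 0))
  refine ⟨φ, v, hB, fun θ u hA => ?_⟩
  have := hopt θ u hA
  rwa [payoff_comp_max hθ0 hA, payoff_comp_max hθ0 hB] at this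
end

section
/- Fix θ0∈(0,π/2), p ≥ 0 and 0 < q < I ≤ 1. Set r = q/I, w = (p/I)/(1 − r + r·ln r), Θ = arctan(tan θ0 + (p/(I cos θ0))/(1 − r + r·ln r)), and U = −ln(r)·cos(Θ−θ0). Then Θ ∈ [θ0, π/2), U > 0, and (Θ,U) is the unique maximizer of the function (θ,u) ↦ p·sin θ − q·u + I·(1 − exp(−u/cos(θ−θ0)))·cos(θ−θ0) over all (θ,u) with θ ∈ (θ0−π/2, θ0+π/2) and u ≥ 0. Moreover sin Θ = (sin θ0 + w)/√(cos²θ0 + (w+sin θ0)²) and cos(Θ−θ0) = (1 + w·sin θ0)/√(cos²θ0 + (w+sin θ0)²). -/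
open Real

lemma one_sub_add_mul_log_pos {r : ℝ} (hr : 0 < r) (hr1 : r < 1) :
    0 < 1 - r + r * Real.log r := by
  have h := Real.log_lt_sub_one_of_pos (inv_pos.mpr hr) (by
    intro h
    rw [inv_eq_one] at h
    exact hr1.ne h)
  rw [Real.log_inv] at h
  have h2 := mul_lt_mul_of_pos_left h hr
  have h3 : r * (r⁻¹ - 1) = 1 - r := by field_simp
  linarith

lemma one_sub_exp_neg_sub_mul_lt {r x : ℝ} (hr : 0 < r) (hx : x ≠ -Real.log r) :
    1 - Real.exp (-x) - r * x < 1 - r + r * Real.log r := by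
  have h := Real.add_one_lt_exp (x := -x - Real.log r) (fun h => hx (by linarith))
  rw [Real.exp_sub, Real.exp_log hr, lt_div_iff₀ hr] at h
  linarith

lemma one_sub_exp_neg_sub_mul_le {r : ℝ} (x : ℝ) (hr : 0 < r) :
    1 - Real.exp (-x) - r * x ≤ 1 - r + r * Real.log r := by
  rcases eq_or_ne x (-Real.log r) with rfl | hx
  · rw [neg_neg, Real.exp_log hr]
    linarith
  · exact (one_sub_exp_neg_sub_mul_lt hr hx).le

lemma sqrt_one_add_div_sq {a c : ℝ} (hc : 0 < c) :
    Real.sqrt (1 + (a / c) ^ 2) = Real.sqrt (c ^ 2 + a ^ 2) / c := by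
  have h : 1 + (a / c) ^ 2 = (c ^ 2 + a ^ 2) / c ^ 2 := by field_simp
  rw [h, Real.sqrt_div' _ (sq_nonneg c), Real.sqrt_sq hc.le]

lemma cos_arctan_div {a c : ℝ} (hc : 0 < c) :
    Real.cos (Real.arctan (a / c)) = c / Real.sqrt (c ^ 2 + a ^ 2) := by
  rw [Real.cos_arctan, sqrt_one_add_div_sq hc, one_div_div]

lemma sin_arctan_div {a c : ℝ} (hc : 0 < c) :
    Real.sin (Real.arctan (a / c)) = a / Real.sqrt (c ^ 2 + a ^ 2) := by
  rw [Real.sin_arctan, sqrt_one_add_div_sq hc]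
  field_simp

lemma cos_lt_one_of_abs_lt {x : ℝ} (hx : |x| < 2 * π) (h0 : x ≠ 0) : Real.cos x < 1 :=
  lt_of_le_of_ne (Real.cos_le_one x) fun h =>
    h0 ((Real.cos_eq_one_iff_of_lt_of_lt (abs_lt.mp hx).1 (abs_lt.mp hx).2).mp h)

/-- Explicit maximizer `(Θ, U)` of `(θ,u) ↦ p·sin θ − q·u + I·G(θ,u)`, together with the
trigonometric identities for `sin Θ` and `cos(Θ − θ0)`. -/
theorem maximizer_formulas (θ0 p q I : ℝ) (hθ0 : θ0 ∈ Set.Ioo 0 (π / 2)) (hp : 0 ≤ p)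
    (hq : 0 < q) (hqI : q < I) (hI : I ≤ 1) :
    let r := q / I
    let w := (p / I) / (1 - r + r * Real.log r)
    let Θ := Real.arctan (Real.tan θ0 + (p / (I * Real.cos θ0)) / (1 - r + r * Real.log r))
    let U := -Real.log r * Real.cos (Θ - θ0)
    Θ ∈ Set.Ico θ0 (π / 2) ∧ 0 < U ∧
    (∀ θ u : ℝ, θ ∈ Set.Ioo (θ0 - π / 2) (θ0 + π / 2) → 0 ≤ u →
      p * Real.sin θ - q * u +
          I * ((1 - Real.exp (-u / Real.cos (θ - θ0))) * Real.cos (θ - θ0)) ≤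
        p * Real.sin Θ - q * U +
          I * ((1 - Real.exp (-U / Real.cos (Θ - θ0))) * Real.cos (Θ - θ0))) ∧
    (∀ θ u : ℝ, θ ∈ Set.Ioo (θ0 - π / 2) (θ0 + π / 2) → 0 ≤ u → (θ, u) ≠ (Θ, U) →
      p * Real.sin θ - q * u +
          I * ((1 - Real.exp (-u / Real.cos (θ - θ0))) * Real.cos (θ - θ0)) <
        p * Real.sin Θ - q * U +
          I * ((1 - Real.exp (-U / Real.cos (Θ - θ0))) * Real.cos (Θ - θ0))) ∧
    Real.sin Θ = (Real.sin θ0 + w) / Real.sqrt (Real.cos θ0 ^ 2 + (w + Real.sin θ0) ^ 2) ∧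
    Real.cos (Θ - θ0) =
      (1 + w * Real.sin θ0) / Real.sqrt (Real.cos θ0 ^ 2 + (w + Real.sin θ0) ^ 2) := by
  intro r w Θ U
  obtain ⟨h0, h1⟩ := hθ0
  have hIpos : 0 < I := hq.trans hqI
  have hr : 0 < r := div_pos hq hIpos
  have hr1 : r < 1 := (div_lt_one hIpos).mpr hqI
  have hD : 0 < 1 - r + r * Real.log r := one_sub_add_mul_log_pos hr hr1
  have hqr : q = I * r := by
    simp only [r]
    field_simp
  have hw : 0 ≤ w := div_nonneg (div_nonneg hp hIpos.le) hD.le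
  have hpw : p = I * (1 - r + r * Real.log r) * w := by
    simp only [w]
    field_simp
  clear_value r
  have hc0 : 0 < Real.cos θ0 := Real.cos_pos_of_mem_Ioo ⟨by linarith, h1⟩
  have hs0 : 0 < Real.sin θ0 := Real.sin_pos_of_pos_of_lt_pi h0 (by linarith)
  have hΘ : Θ = Real.arctan ((w + Real.sin θ0) / Real.cos θ0) := by
    simp only [Θ, w]
    congr 1
    rw [Real.tan_eq_sin_div_cos]
    field_simp
    ring
  clear_value Θ w
  set R := Real.sqrt (Real.cos θ0 ^ 2 + (w + Real.sin θ0) ^ 2) with hR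
  have hRpos : 0 < R := Real.sqrt_pos.mpr (by positivity)
  have hcosΘ : Real.cos Θ = Real.cos θ0 / R := by rw [hΘ, cos_arctan_div hc0]
  have hsinΘ : Real.sin Θ = (w + Real.sin θ0) / R := by rw [hΘ, sin_arctan_div hc0]
  have hΘlt : Θ < π / 2 := hΘ ▸ Real.arctan_lt_pi_div_two _
  have hΘge : θ0 ≤ Θ := by
    calc θ0 = Real.arctan (Real.tan θ0) := (Real.arctan_tan (by linarith) h1).symm
      _ ≤ Θ := by
        rw [hΘ, Real.tan_eq_sin_div_cos]
        apply Real.arctan_mono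
        gcongr
        linarith
  have hcosdiff : Real.cos (Θ - θ0) = (1 + w * Real.sin θ0) / R := by
    rw [Real.cos_sub, hcosΘ, hsinΘ]
    field_simp
    linear_combination Real.sin_sq_add_cos_sq θ0
  have hcpos : 0 < Real.cos (Θ - θ0) := by
    rw [hcosdiff]
    positivity
  have hU : 0 < U := mul_pos (neg_pos.mpr (Real.log_neg hr hr1)) hcpos
  have hprofile : ∀ θ : ℝ, p * Real.sin θ + I * (1 - r + r * Real.log r) * Real.cos (θ - θ0) =
      I * (1 - r + r * Real.log r) * R * Real.cos (θ - Θ) := by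
    intro θ
    rw [Real.cos_sub, Real.cos_sub, hcosΘ, hsinΘ, hpw]
    field_simp
    ring
  have hvalue : p * Real.sin Θ - q * U +
      I * ((1 - Real.exp (-U / Real.cos (Θ - θ0))) * Real.cos (Θ - θ0)) =
      I * (1 - r + r * Real.log r) * R := by
    have hdiv : -U / Real.cos (Θ - θ0) = Real.log r := by
      simp only [U]
      field_simp
    have h := hprofile Θ
    rw [sub_self, Real.cos_zero, mul_one] at h
    rw [hdiv, Real.exp_log hr, ← h, hqr]
    simp only [U]
    ring
  have hsubst : ∀ θ u : ℝ, 0 < Real.cos (θ - θ0) →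
      p * Real.sin θ - q * u +
          I * ((1 - Real.exp (-u / Real.cos (θ - θ0))) * Real.cos (θ - θ0)) =
        p * Real.sin θ + I * Real.cos (θ - θ0) * (1 - Real.exp (-(u / Real.cos (θ - θ0))) -
          r * (u / Real.cos (θ - θ0))) := by
    intro θ u hc
    rw [hqr, neg_div]
    field_simp
    ring
  have hstrict : ∀ θ u : ℝ, θ ∈ Set.Ioo (θ0 - π / 2) (θ0 + π / 2) → 0 ≤ u → (θ, u) ≠ (Θ, U) →
      p * Real.sin θ - q * u +
          I * ((1 - Real.exp (-u / Real.cos (θ - θ0))) * Real.cos (θ - θ0)) <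
        p * Real.sin Θ - q * U +
          I * ((1 - Real.exp (-U / Real.cos (Θ - θ0))) * Real.cos (Θ - θ0)) := by
    intro θ u hθ _ hne
    have hc : 0 < Real.cos (θ - θ0) :=
      Real.cos_pos_of_mem_Ioo ⟨by linarith [hθ.1], by linarith [hθ.2]⟩
    have hIc : 0 < I * Real.cos (θ - θ0) := mul_pos hIpos hc
    have hK : 0 < I * (1 - r + r * Real.log r) * R := by positivity
    rw [hvalue, hsubst θ u hc]
    have hθprofile := hprofile θ
    rcases eq_or_ne θ Θ with rfl | hθne
    · have hx : u / Real.cos (θ - θ0) ≠ -Real.log r := by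
        intro hx
        rw [div_eq_iff hc.ne'] at hx
        exact hne (by rw [hx])
      have h := mul_lt_mul_of_pos_left (one_sub_exp_neg_sub_mul_lt hr hx) hIc
      rw [sub_self, Real.cos_zero] at hθprofile
      linarith
    · have h := mul_le_mul_of_nonneg_left
        (one_sub_exp_neg_sub_mul_le (u / Real.cos (θ - θ0)) hr) hIc.le
      have hlt : Real.cos (θ - Θ) < 1 := cos_lt_one_of_abs_lt
        (abs_lt.mpr ⟨by linarith [hθ.1], by linarith [hθ.2]⟩) (sub_ne_zero.mpr hθne)
      have h2 := mul_lt_mul_of_pos_left hlt hK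
      linarith
  refine ⟨⟨hΘge, hΘlt⟩, hU, ?_, hstrict, ?_, hcosdiff⟩
  · intro θ u hθ hu
    rcases eq_or_ne (θ, u) (Θ, U) with h | h
    · obtain ⟨rfl, rfl⟩ := Prod.mk.inj h
      exact le_rfl
    · exact (hstrict θ u hθ hu h).le
  · rw [hsinΘ, add_comm]
end
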